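/- arXiv:2503.05506 — 3 statements merged into one kernel-verified Lean document; each statement's English description precedes it below -/
import Mathlib

section
/- Let G be a 3-connected edge-pancyclic graph of order n. Then e(G) ≥ 2n − 2, and equality holds if and only if G is isomorphic to the wheel graph W_n. -/
/-- The edge `e` lies in a cycle of length `k` in the graph `G`. -/
def SimpleGraph.EdgeInCycleOfLength {V : Type*} (G : SimpleGraph V) (e : Sym2 V) (k : ℕ) : Prop :=
  ∃ (v : V) (c : G.Walk v v), c.IsCycle ∧ c.length = k ∧ e ∈ c.edges

/-- A graph `G` of order `n` is edge-pancyclic if for every `k` with `3 ≤ k ≤ n`,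
every edge of `G` lies in a cycle of length `k`. -/
def SimpleGraph.EdgePancyclic {V : Type*} [Fintype V] (G : SimpleGraph V) : Prop :=
  ∀ k : ℕ, 3 ≤ k → k ≤ Fintype.card V → ∀ e ∈ G.edgeSet, G.EdgeInCycleOfLength e k

/-- A graph `G` is `k`-edge-proper if every edge of `G` lies in a cycle of length `i`
for every `3 ≤ i ≤ k`, and every edge of `G` lies in a Hamilton cycle of `G`. -/
def SimpleGraph.EdgeProper {V : Type*} [Fintype V] [DecidableEq V]
    (G : SimpleGraph V) (k : ℕ) : Prop :=
  ∀ e ∈ G.edgeSet,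
    (∀ i : ℕ, 3 ≤ i → i ≤ k → G.EdgeInCycleOfLength e i) ∧
    ∃ (v : V) (c : G.Walk v v), c.IsHamiltonianCycle ∧ e ∈ c.edges

/-- The wheel graph of order `n`: vertex `0` is the hub, joined to every vertex of the
cycle `1, 2, …, n-1` (which has edges `i — i+1` for `1 ≤ i ≤ n-2` and `1 — (n-1)`). -/
def wheelGraph (n : ℕ) : SimpleGraph (Fin n) :=
  SimpleGraph.fromRel (fun a b =>
    a.val = 0 ∨
    (a.val ≠ 0 ∧ b.val ≠ 0 ∧ (a.val + 1 = b.val ∨ (a.val = 1 ∧ b.val = n - 1))))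

/-- A graph is 3-connected if it has at least 4 vertices and removing any set of at most 2
vertices leaves a connected graph (i.e. its connectivity is at least 3). -/
def ThreeConnected {V : Type*} [Fintype V] (G : SimpleGraph V) : Prop :=
  4 ≤ Fintype.card V ∧ ∀ S : Set V, S.ncard ≤ 2 → (G.induce Sᶜ).Connected

/-- `TriBuild k S E`: the edge set `E` on the vertex set `S` arises from a single edge by repeatedly
joining a new vertex to both ends of an edge, and `k` times adding a chord. -/
inductive TriBuild {V : Type*} [DecidableEq V] : ℕ → Finset V → Finset (Sym2 V) → Prop
  | edge {a b : V} : a ≠ b → TriBuild 0 {a, b} {s(a, b)}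
  | cone {k : ℕ} {S : Finset V} {E : Finset (Sym2 V)} {a b c : V} :
      TriBuild k S E → s(a, b) ∈ E → c ∉ S →
      TriBuild k (insert c S) (insert s(a, c) (insert s(b, c) E))
  | chord {k : ℕ} {S : Finset V} {E : Finset (Sym2 V)} {a b : V} :
      TriBuild k S E → a ∈ S → b ∈ S → a ≠ b → s(a, b) ∉ E →
      TriBuild (k + 1) S (insert s(a, b) E)

/-- The vertex `w` has at most two neighbours along the edges in `E`. -/
def HasAtMostTwoNeighbors {V : Type*} (E : Finset (Sym2 V)) (w : V) : Prop :=
  ∃ a b : V, ∀ u, s(w, u) ∈ E → u = a ∨ u = b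

/-- `E` is the edge set of a fan on `S` with centre `p 0` and path `p 1, …, p m`. -/
structure IsFan {V : Type*} (S : Finset V) (E : Finset (Sym2 V)) (x y z : V) (m : ℕ)
    (p : ℕ → V) : Prop where
  two_le : 2 ≤ m
  center : p 0 = z
  first : p 1 = x
  last : p m = y
  inj : ∀ i ≤ m, ∀ j ≤ m, p i = p j → i = j
  mem_iff : ∀ v, v ∈ S ↔ ∃ i ≤ m, p i = v
  adj_iff : ∀ i ≤ m, ∀ j ≤ m,
    (s(p i, p j) ∈ E ↔ i ≠ j ∧ (i = 0 ∨ j = 0 ∨ i + 1 = j ∨ j + 1 = i))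

namespace TriBuild

variable {V : Type*} [DecidableEq V] {k : ℕ} {S : Finset V} {E : Finset (Sym2 V)}

theorem mem_of_mem (h : TriBuild k S E) :
    ∀ {a b : V}, s(a, b) ∈ E → a ∈ S ∧ b ∈ S ∧ a ≠ b := by
  induction h with
  | edge hab => intro u v h; simp at h; grind
  | @cone k S E a b c _ hab hc ih =>
    intro u v h
    have := ih hab
    have ihuv := @ih u v
    simp at h ⊢
    grind
  | @chord k S E a b _ ha hb hab _ ih =>
    intro u v h
    have ihuv := @ih u v
    simp at h ⊢
    grind

theorem exists_mem (h : TriBuild k S E) : ∀ v ∈ S, ∃ u, s(v, u) ∈ E := by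
  induction h with
  | @edge a b hab =>
    intro v hv
    simp at hv
    rcases hv with rfl | rfl
    · exact ⟨b, by simp⟩
    · exact ⟨a, by simp [Sym2.eq_swap]⟩
  | @cone k S E a b c _ hab hc ih =>
    intro v hv
    rcases Finset.mem_insert.1 hv with rfl | hv
    · exact ⟨a, by simp [Sym2.eq_swap]⟩
    · obtain ⟨u, hu⟩ := ih v hv
      exact ⟨u, by simp [hu]⟩
  | @chord k S E a b _ ha hb hab _ ih =>
    intro v hv
    obtain ⟨u, hu⟩ := ih v hv
    exact ⟨u, by simp [hu]⟩

theorem card_eq (h : TriBuild k S E) : E.card + 3 = 2 * S.card + k := by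
  induction h with
  | edge hab => simp [Finset.card_pair hab]
  | @cone k S E a b c h hab hc ih =>
    have h1 : s(b, c) ∉ E := fun h' => hc (h.mem_of_mem h').2.1
    have h2 : s(a, c) ∉ insert s(b, c) E := by
      have hab' := h.mem_of_mem hab
      have : s(a, c) ∉ E := fun h' => hc (h.mem_of_mem h').2.1
      simp
      grind
    rw [Finset.card_insert_of_notMem h2, Finset.card_insert_of_notMem h1,
      Finset.card_insert_of_notMem hc]
    omega
  | @chord k S E a b _ ha hb hab hE ih =>
    rw [Finset.card_insert_of_notMem hE]
    omega

/-- Inserting a cone over an edge only affects the neighbourhoods of the apex and the two ends. -/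
theorem mem_cone_iff {a b c w u : V} (ha : w ≠ a) (hb : w ≠ b) (hc : w ≠ c) :
    s(w, u) ∈ insert s(a, c) (insert s(b, c) E) ↔ s(w, u) ∈ E := by
  simp
  grind

theorem mem_cone_apex_iff (h : TriBuild k S E) {a b c u : V} (hc : c ∉ S) :
    s(c, u) ∈ insert s(a, c) (insert s(b, c) E) ↔ u = a ∨ u = b := by
  have : s(c, u) ∉ E := fun h' => hc (h.mem_of_mem h').1
  simp
  grind

theorem two_le_card (h : TriBuild k S E) : 2 ≤ S.card := by
  induction h with
  | edge hab => simp [Finset.card_pair hab]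
  | cone h hab hc ih => rw [Finset.card_insert_of_notMem hc]; omega
  | chord _ _ _ _ _ ih => exact ih

theorem eq_of_card_eq_two (h : TriBuild k S E) (hS : S.card = 2) {a b : V} (hab : s(a, b) ∈ E) :
    S = {a, b} := by
  obtain ⟨ha, hb, hne⟩ := h.mem_of_mem hab
  refine (Finset.eq_of_subset_of_card_le ?_ ?_).symm
  · intro v hv
    simp at hv
    grind
  · rw [hS, Finset.card_pair hne]

/-- Besides the ends of a given edge, a graph built from cones has a vertex of degree at most 2. -/
theorem exists_low (h : TriBuild k S E) (hk : k = 0) (hS : 3 ≤ S.card) {x y : V}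
    (hxy : s(x, y) ∈ E) : ∃ w ∈ S, w ≠ x ∧ w ≠ y ∧ HasAtMostTwoNeighbors E w := by
  induction h generalizing x y with
  | @edge a b hab => simp [Finset.card_pair hab] at hS
  | @cone k S E a b c h hab hc ih =>
    by_cases hcxy : c ≠ x ∧ c ≠ y
    · exact ⟨c, by simp, hcxy.1, hcxy.2, a, b, fun u hu => (h.mem_cone_apex_iff hc).1 hu⟩
    have hmem := h.mem_of_mem hab
    have hends : (x = c ∧ (y = a ∨ y = b)) ∨ (y = c ∧ (x = a ∨ x = b)) := by
      by_cases hx : c = x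
      · subst hx
        exact Or.inl ⟨rfl, (h.mem_cone_apex_iff hc).1 hxy⟩
      · have hy : c = y := by grind
        subst hy
        rw [Sym2.eq_swap (a := x)] at hxy
        exact Or.inr ⟨rfl, (h.mem_cone_apex_iff hc).1 hxy⟩
    by_cases h3 : 3 ≤ S.card
    · obtain ⟨w, hwS, hwa, hwb, u, v, huv⟩ := ih hk h3 hab
      have hwc : w ≠ c := fun h' => hc (h' ▸ hwS)
      refine ⟨w, by simp [hwS], by grind, by grind, u, v, fun t ht => huv t ?_⟩
      exact (mem_cone_iff hwa hwb hwc).1 ht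
    · have hS2 : S = {a, b} := h.eq_of_card_eq_two (by have := h.two_le_card; omega) hab
      have key : ∀ w, w ≠ c → w = a ∨ w = b →
          HasAtMostTwoNeighbors (insert s(a, c) (insert s(b, c) E)) w := by
        intro w hwc hw
        refine ⟨c, if w = a then b else a, fun u hu => ?_⟩
        have := fun h' : s(w, u) ∈ E => h.mem_of_mem h'
        simp at hu
        grind
      rcases hends with ⟨rfl, rfl | rfl⟩ | ⟨rfl, rfl | rfl⟩
      · exact ⟨b, by simp [hS2], by grind, by grind, key b (by grind) (by simp)⟩
      · exact ⟨a, by simp [hS2], by grind, by grind, key a (by grind) (by simp)⟩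
      · exact ⟨b, by simp [hS2], by grind, by grind, key b (by grind) (by simp)⟩
      · exact ⟨a, by simp [hS2], by grind, by grind, key a (by grind) (by simp)⟩
  | chord => omega

end TriBuild

theorem IsFan.reverse {V : Type*} {S : Finset V} {E : Finset (Sym2 V)} {x y z : V} {m : ℕ}
    {p : ℕ → V} (h : IsFan S E x y z m p) :
    IsFan S E y x z m (fun i => if i = 0 then p 0 else p (m + 1 - i)) := by
  have hm := h.two_le
  let q : ℕ → ℕ := fun i => if i = 0 then 0 else m + 1 - i
  have hq : (fun i => if i = 0 then p 0 else p (m + 1 - i)) = fun i => p (q i) := by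
    funext i
    by_cases hi : i = 0 <;> simp [q, hi]
  have hqm : ∀ i ≤ m, q i ≤ m := by intro i hi; simp only [q]; split <;> omega
  rw [hq]
  refine ⟨hm, ?_, ?_, ?_, ?_, ?_, ?_⟩
  · simpa [q] using h.center
  · simpa [q] using h.last
  · have : q m = 1 := by simp only [q]; split <;> omega
    simpa [this] using h.first
  · intro i hi j hj hij
    have := h.inj _ (hqm i hi) _ (hqm j hj) hij
    simp only [q] at this
    split at this <;> split at this <;> omega
  · intro v
    rw [h.mem_iff]
    constructor
    · rintro ⟨i, hi, rfl⟩
      refine ⟨q i, hqm i hi, ?_⟩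
      have : q (q i) = i := by simp only [q]; split <;> split <;> omega
      rw [this]
    · rintro ⟨i, hi, rfl⟩
      exact ⟨q i, hqm i hi, rfl⟩
  · intro i hi j hj
    show s(p (q i), p (q j)) ∈ E ↔ _
    rw [h.adj_iff _ (hqm i hi) _ (hqm j hj)]
    simp only [q]
    split <;> split <;> omega

theorem IsFan.extend {V : Type*} [DecidableEq V] {S : Finset V} {E : Finset (Sym2 V)}
    {x y z c : V} {m : ℕ} {p : ℕ → V} (h : IsFan S E x y z m p) (hc : c ∉ S)
    (hE : ∀ u, s(c, u) ∉ E) :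
    IsFan (insert c S) (insert s(z, c) (insert s(y, c) E)) x c z (m + 1)
      (Function.update p (m + 1) c) := by
  have hm := h.two_le
  have hlt : ∀ i ≤ m, Function.update p (m + 1) c i = p i := by
    intro i hi
    rw [Function.update_of_ne (by omega)]
  have htop : Function.update p (m + 1) c (m + 1) = c := Function.update_self ..
  have hpc : ∀ i ≤ m, p i ≠ c := fun i hi h' => hc ((h.mem_iff c).2 ⟨i, hi, h'⟩)
  have hz : ∀ i ≤ m, (p i = z ↔ i = 0) := fun i hi =>
    ⟨fun h' => h.inj i hi 0 (by omega) (h'.trans h.center.symm), fun h' => h' ▸ h.center⟩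
  have hy : ∀ i ≤ m, (p i = y ↔ i = m) := fun i hi =>
    ⟨fun h' => h.inj i hi m le_rfl (h'.trans h.last.symm), fun h' => h' ▸ h.last⟩
  have htopadj : ∀ i ≤ m, (s(p i, c) ∈ insert s(z, c) (insert s(y, c) E) ↔ i = 0 ∨ i = m) := by
    intro i hi
    have h1 : s(p i, c) ∉ E := by rw [Sym2.eq_swap]; exact hE _
    have h2 := hpc i hi
    rw [← hz i hi, ← hy i hi]
    simp
    grind
  refine ⟨by omega, ?_, ?_, htop, ?_, ?_, ?_⟩
  · rw [hlt 0 (by omega), h.center]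
  · rw [hlt 1 (by omega), h.first]
  · intro i hi j hj hij
    rcases Nat.lt_or_ge m i with h1 | h1 <;> rcases Nat.lt_or_ge m j with h2 | h2
    · omega
    · obtain rfl : i = m + 1 := by omega
      rw [htop, hlt j h2] at hij
      exact absurd hij.symm (hpc j h2)
    · obtain rfl : j = m + 1 := by omega
      rw [htop, hlt i h1] at hij
      exact absurd hij (hpc i h1)
    · rw [hlt i h1, hlt j h2] at hij
      exact h.inj i h1 j h2 hij
  · intro v
    rw [Finset.mem_insert, h.mem_iff]
    constructor
    · rintro (rfl | ⟨i, hi, rfl⟩)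
      · exact ⟨m + 1, le_rfl, htop⟩
      · exact ⟨i, by omega, hlt i hi⟩
    · rintro ⟨i, hi, rfl⟩
      rcases Nat.lt_or_ge m i with h1 | h1
      · obtain rfl : i = m + 1 := by omega
        exact Or.inl htop
      · exact Or.inr ⟨i, h1, (hlt i h1).symm⟩
  · intro i hi j hj
    rcases Nat.lt_or_ge m i with h1 | h1 <;> rcases Nat.lt_or_ge m j with h2 | h2
    · obtain rfl : i = m + 1 := by omega
      obtain rfl : j = m + 1 := by omega
      have h1 := hE c
      have h2 := hpc 0 (by omega)
      have h3 := hpc m (by omega)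
      rw [h.center] at h2
      rw [h.last] at h3
      simp
      grind
    · obtain rfl : i = m + 1 := by omega
      rw [htop, hlt j h2, Sym2.eq_swap (a := c) (b := p j), htopadj j h2]
      omega
    · obtain rfl : j = m + 1 := by omega
      rw [htop, hlt i h1, htopadj i h1]
      omega
    · rw [hlt i h1, hlt j h2, ← h.adj_iff i h1 j h2]
      have := hpc i h1
      have := hpc j h2
      simp
      grind

theorem isFan_triangle {V : Type*} [DecidableEq V] {a b c : V} (hab : a ≠ b) (hac : a ≠ c)
    (hbc : b ≠ c) {E : Finset (Sym2 V)} {S : Finset V} (h1 : s(a, b) ∈ E) (h2 : s(a, c) ∈ E)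
    (h3 : s(b, c) ∈ E) (hloop : ∀ v, s(v, v) ∉ E) (hS : ∀ v, v ∈ S ↔ v = a ∨ v = b ∨ v = c) :
    IsFan S E b c a 2 (fun i => if i = 0 then a else if i = 1 then b else c) := by
  have h1' : s(b, a) ∈ E := by rwa [Sym2.eq_swap]
  have h2' : s(c, a) ∈ E := by rwa [Sym2.eq_swap]
  have h3' : s(c, b) ∈ E := by rwa [Sym2.eq_swap]
  refine ⟨le_rfl, rfl, rfl, rfl, ?_, ?_, ?_⟩
  · intro i hi j hj
    interval_cases i <;> interval_cases j <;> simp <;> grind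
  · intro v
    rw [hS]
    constructor
    · rintro (rfl | rfl | rfl)
      · exact ⟨0, by simp⟩
      · exact ⟨1, by simp⟩
      · exact ⟨2, by simp⟩
    · rintro ⟨i, hi, rfl⟩
      interval_cases i <;> simp
  · intro i hi j hj
    interval_cases i <;> interval_cases j <;> simp [*]

namespace TriBuild

variable {V : Type*} [DecidableEq V] {k : ℕ} {S : Finset V} {E : Finset (Sym2 V)}

theorem exists_isFan (h : TriBuild k S E) (hk : k = 0) {x y z : V} (hxy : x ≠ y)
    (hxz : s(x, z) ∈ E) (hyz : s(y, z) ∈ E)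
    (hdeg : ∀ w ∈ S, w ≠ x → w ≠ y → w ≠ z → ¬ HasAtMostTwoNeighbors E w) :
    ∃ m p, IsFan S E x y z m p := by
  induction h generalizing x y with
  | @edge a b hab => simp at hxz hyz; grind
  | @cone k S E a b c h hab hc ih =>
    have hfull := h.cone hab hc
    have hx := hfull.mem_of_mem hxz
    have hy := hfull.mem_of_mem hyz
    have hmem := h.mem_of_mem hab
    have hcE : ∀ u, s(c, u) ∉ E := fun u h' => hc (h.mem_of_mem h').1
    have hcase : c = x ∨ c = y ∨ c = z := by
      by_contra! hne
      exact hdeg c (by simp) hne.1 hne.2.1 hne.2.2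
        ⟨a, b, fun u hu => (h.mem_cone_apex_iff hc).1 hu⟩
    by_cases h3 : 3 ≤ S.card
    · have hlow : ¬ ((x = a ∨ x = b ∨ x = c) ∧ (y = a ∨ y = b ∨ y = c) ∧
          (z = a ∨ z = b ∨ z = c)) := by
        rintro ⟨h1, h2, h4⟩
        obtain ⟨w, hwS, hwa, hwb, u, v, huv⟩ := h.exists_low hk h3 hab
        have hwc : w ≠ c := fun h' => hc (h' ▸ hwS)
        refine hdeg w (by simp [hwS]) (by grind) (by grind) (by grind) ⟨u, v, fun t ht => huv t ?_⟩
        exact (mem_cone_iff hwa hwb hwc).1 ht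
      have extend_at : ∀ {y a b : V}, y ≠ c → y ≠ b →
          s(y, z) ∈ E → s(a, b) ∈ E → z = a →
          (∀ w ∈ insert c S, w ≠ c → w ≠ y → w ≠ z →
            ¬ HasAtMostTwoNeighbors (insert s(a, c) (insert s(b, c) E)) w) →
          ∃ m p, IsFan (insert c S) (insert s(a, c) (insert s(b, c) E)) y c z m p := by
        intro y a b hyc hyb hyz hab hza hdeg
        subst hza
        obtain ⟨m, p, hp⟩ := ih hk hyb hyz (by rwa [Sym2.eq_swap]) (by
          rintro w hwS hwy hwb hwz ⟨u, v, huv⟩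
          have hwc : w ≠ c := fun h' => hc (h' ▸ hwS)
          exact hdeg w (by simp [hwS]) hwc hwy hwz
            ⟨u, v, fun t ht => huv t ((mem_cone_iff hwz hwb hwc).1 ht)⟩)
        exact ⟨_, _, hp.extend hc hcE⟩
      have fan_to_apex : ∀ {y : V}, s(c, z) ∈ insert s(a, c) (insert s(b, c) E) → y ≠ c →
          s(y, z) ∈ insert s(a, c) (insert s(b, c) E) →
          ¬ ((y = a ∨ y = b) ∧ (z = a ∨ z = b)) →
          (∀ w ∈ insert c S, w ≠ c → w ≠ y → w ≠ z →
            ¬ HasAtMostTwoNeighbors (insert s(a, c) (insert s(b, c) E)) w) →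
          ∃ m p, IsFan (insert c S) (insert s(a, c) (insert s(b, c) E)) y c z m p := by
        intro y hcz hyc hyz hnot hdeg
        have hza := (h.mem_cone_apex_iff hc).1 hcz
        have hyz' : s(y, z) ∈ E := by
          have : z ≠ c := by grind
          exact (mem_cone_iff (by grind) (by grind) hyc).1 hyz
        rcases hza with hza | hzb
        · exact extend_at hyc (by grind) hyz' hab hza hdeg
        · rw [Finset.insert_comm] at hcz hdeg ⊢
          exact extend_at hyc (by grind) hyz' (by rwa [Sym2.eq_swap]) hzb hdeg
      rcases hcase with rfl | rfl | rfl
      · obtain ⟨m, p, hp⟩ := fan_to_apex hxz hxy.symm hyz (by grind) hdeg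
        exact ⟨_, _, hp.reverse⟩
      · exact fan_to_apex hyz hxy hxz (by grind) (fun w hw h1 h2 => hdeg w hw h2 h1)
      · rw [Sym2.eq_swap (a := x)] at hxz
        rw [Sym2.eq_swap (a := y)] at hyz
        have := (h.mem_cone_apex_iff hc).1 hxz
        have := (h.mem_cone_apex_iff hc).1 hyz
        grind
    · have hS2 : S = {a, b} := h.eq_of_card_eq_two (by have := h.two_le_card; omega) hab
      have hS' : ∀ v, v ∈ insert c S ↔ v = a ∨ v = b ∨ v = c := by
        intro v
        simp [hS2]
        tauto
      have hxyE : s(x, y) ∈ insert s(a, c) (insert s(b, c) E) := by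
        have h1 := (hS' x).1 hx.1
        have h2 := (hS' y).1 hy.1
        have hba : s(b, a) ∈ E := by rwa [Sym2.eq_swap]
        simp
        grind
      refine ⟨_, _, isFan_triangle hx.2.2.symm hy.2.2.symm hxy (Sym2.eq_swap (a := x) ▸ hxz)
        (Sym2.eq_swap (a := y) ▸ hyz) hxyE (fun v hv => (hfull.mem_of_mem hv).2.2 rfl) ?_⟩
      intro v
      have h1 := (hS' x).1 hx.1
      have h2 := (hS' y).1 hy.1
      have h4 := (hS' z).1 hx.2.1
      rw [hS']
      grind
  | chord => omega

end TriBuild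

/-- Two edges of `G` are related if they are two sides of a common triangle. -/
def SimpleGraph.InCommonTriangle {V : Type*} (G : SimpleGraph V) (e f : Sym2 V) : Prop :=
  ∃ a b c, G.Adj a b ∧ G.Adj a c ∧ G.Adj b c ∧ e = s(a, b) ∧ f = s(a, c)

namespace SimpleGraph

theorem InCommonTriangle.symm {V : Type*} {G : SimpleGraph V} {e f : Sym2 V}
    (h : G.InCommonTriangle e f) : G.InCommonTriangle f e := by
  obtain ⟨a, b, c, h1, h2, h3, he, hf⟩ := h
  exact ⟨a, c, b, h2, h1, h3.symm, hf, he⟩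

theorem reflTransGen_inCommonTriangle_symm {V : Type*} {G : SimpleGraph V} {e f : Sym2 V}
    (h : Relation.ReflTransGen G.InCommonTriangle e f) :
    Relation.ReflTransGen G.InCommonTriangle f e := by
  induction h with
  | refl => exact .refl
  | tail _ h ih => exact .head h.symm ih

variable {V : Type*} [Fintype V] (G : SimpleGraph V) [DecidableRel G.Adj]

open Classical in
/-- The edges of `G` reachable from `e` through triangles. -/
noncomputable def triangleClass (e : Sym2 V) : Finset (Sym2 V) :=
  {f ∈ G.edgeFinset | Relation.ReflTransGen G.InCommonTriangle e f}

/-- The vertices covered by a set of edges. -/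
def coveredVertices [DecidableEq V] (E : Finset (Sym2 V)) : Finset V :=
  {v | ∃ u, s(v, u) ∈ E}

variable {G}

theorem mem_triangleClass {e f : Sym2 V} :
    f ∈ G.triangleClass e ↔ f ∈ G.edgeSet ∧ Relation.ReflTransGen G.InCommonTriangle e f := by
  simp [triangleClass]

theorem triangleClass_eq_iff {e f : Sym2 V} (hf : f ∈ G.edgeSet) :
    G.triangleClass f = G.triangleClass e ↔ f ∈ G.triangleClass e := by
  constructor
  · intro h
    rw [← h, mem_triangleClass]
    exact ⟨hf, .refl⟩
  · intro h
    have h' := (mem_triangleClass.1 h).2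
    ext g
    rw [mem_triangleClass, mem_triangleClass]
    exact ⟨fun hg => ⟨hg.1, h'.trans hg.2⟩,
      fun hg => ⟨hg.1, (reflTransGen_inCommonTriangle_symm h').trans hg.2⟩⟩

theorem mem_triangleClass_of_triangle {e : Sym2 V} {a b c : V} (h : s(a, b) ∈ G.triangleClass e)
    (hac : G.Adj a c) (hbc : G.Adj b c) : s(a, c) ∈ G.triangleClass e := by
  rw [mem_triangleClass] at h ⊢
  exact ⟨hac, h.2.tail ⟨a, b, c, h.1, hac, hbc, rfl, rfl⟩⟩

variable [DecidableEq V]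

theorem mem_coveredVertices {E : Finset (Sym2 V)} {v : V} :
    v ∈ coveredVertices E ↔ ∃ u, s(v, u) ∈ E := by
  simp [coveredVertices]

theorem exists_triBuild_triangleClass {e : Sym2 V} (he : e ∈ G.edgeSet) :
    ∃ k, TriBuild k (coveredVertices (G.triangleClass e)) (G.triangleClass e) := by
  classical
  let F := {E ∈ (G.triangleClass e).powerset | e ∈ E ∧ ∃ k S, TriBuild k S E}
  have hF : ∀ E, E ∈ F ↔ E ⊆ G.triangleClass e ∧ e ∈ E ∧ ∃ k S, TriBuild k S E := by
    intro E; simp [F]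
  have hne : F.Nonempty := by
    refine ⟨{e}, (hF _).2 ⟨?_, by simp, ?_⟩⟩
    · simp [mem_triangleClass, he, Relation.ReflTransGen.refl]
    · induction e with
      | h a b => exact ⟨0, _, .edge (G.ne_of_adj he)⟩
  obtain ⟨E, hE, hmax⟩ := Finset.exists_max_image F Finset.card hne
  obtain ⟨hsub, heE, k, S, hb⟩ := (hF E).1 hE
  have noext : ∀ E', E' ⊆ G.triangleClass e → E ⊆ E' → (∃ k S, TriBuild k S E') → E' ⊆ E := by
    intro E' h1 h2 h3
    have := hmax E' ((hF E').2 ⟨h1, h2 heE, h3⟩)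
    exact (Finset.eq_of_subset_of_card_le h2 this).ge
  have hclosed : ∀ f g, f ∈ E → G.InCommonTriangle f g → g ∈ E := by
    rintro f g hf ⟨a, b, c, hab, hac, hbc, rfl, rfl⟩
    by_contra hg
    have hac' := mem_triangleClass_of_triangle (hsub hf) hac hbc
    have hmem := hb.mem_of_mem hf
    by_cases hc : c ∈ S
    · refine hg (noext _ ?_ (Finset.subset_insert _ _)
        ⟨_, _, hb.chord hmem.1 hc hac.ne hg⟩ (Finset.mem_insert_self _ _))
      exact Finset.insert_subset hac' hsub
    · have hbc' : s(b, c) ∈ G.triangleClass e :=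
        mem_triangleClass_of_triangle (a := b) (b := a) (Sym2.eq_swap ▸ hsub hf) hbc hac
      refine hg (noext _ ?_ ?_ ⟨_, _, hb.cone hf hc⟩ (Finset.mem_insert_self _ _))
      · exact Finset.insert_subset hac' (Finset.insert_subset hbc' hsub)
      · exact (Finset.subset_insert _ _).trans (Finset.subset_insert _ _)
  have hEeq : E = G.triangleClass e := by
    refine hsub.antisymm fun f hf => ?_
    have := (mem_triangleClass.1 hf).2
    clear hf
    induction this with
    | refl => exact heE
    | tail _ h ih => exact hclosed _ _ ih h
  rw [← hEeq]
  refine ⟨k, ?_⟩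
  have : coveredVertices E = S := by
    ext v
    rw [mem_coveredVertices]
    exact ⟨fun ⟨u, hu⟩ => (hb.mem_of_mem hu).1, hb.exists_mem v⟩
  rwa [this]

end SimpleGraph

section ThreeConnected

open SimpleGraph

variable {V : Type*} [Fintype V] {G : SimpleGraph V}

/-- A nonempty set with at most two boundary vertices is everything outside the boundary. -/
theorem ThreeConnected.mem_of_closed (h3 : ThreeConnected G) {A W : Set V} (hA : A.ncard ≤ 2)
    {v : V} (hv : v ∈ W) (hvA : v ∉ A) (hW : ∀ x ∈ W, x ∉ A → ∀ y, G.Adj x y → y ∈ W) {y : V}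
    (hy : y ∉ A) : y ∈ W := by
  obtain ⟨w⟩ := (h3.2 A hA).preconnected ⟨v, hvA⟩ ⟨y, hy⟩
  have key : ∀ a b : (Aᶜ : Set V), (G.induce Aᶜ).Walk a b → a.1 ∈ W → b.1 ∈ W := by
    intro a b w
    induction w with
    | nil => exact id
    | @cons a b c hab _ ih => exact fun ha => ih (hW _ ha a.2 _ hab)
  exact key _ _ w hv

theorem ThreeConnected.not_low (h3 : ThreeConnected G) {E : Finset (Sym2 V)}
    (hE : ∀ a b, G.Adj a b → s(a, b) ∈ E) (w : V) : ¬ HasAtMostTwoNeighbors E w := by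
  classical
  rintro ⟨a, b, hab⟩
  have hcard : ({a, b, w} : Finset V).card < (Finset.univ : Finset V).card := by
    have := Finset.card_le_three (a := a) (b := b) (c := w)
    have := h3.1
    rw [Finset.card_univ]
    omega
  obtain ⟨y, -, hy⟩ := Finset.exists_mem_notMem_of_card_lt_card hcard
  simp at hy
  have hA : (({a, b} : Set V) \ {w}).ncard ≤ 2 := by
    refine (Set.ncard_le_ncard Set.sdiff_subset (Set.toFinite _)).trans ?_
    exact (Set.ncard_insert_le _ _).trans (by simp)
  have := h3.mem_of_closed (W := {a, b, w}) (v := w) (y := y) hA (by simp) (by simp)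
    (fun x hx hxA y hxy => by
      have hxw : x = w := by simp at hx hxA; tauto
      subst hxw
      have := hab y (hE _ _ hxy)
      simp; tauto) (by simp; tauto)
  simp at this
  tauto

theorem ThreeConnected.covered_univ [DecidableEq V] (h3 : ThreeConnected G) {E : Finset (Sym2 V)}
    (hE : ∀ a b, G.Adj a b → s(a, b) ∈ E) : coveredVertices E = Finset.univ := by
  ext v
  simp only [mem_coveredVertices, Finset.mem_univ, iff_true]
  by_contra! hv
  exact h3.not_low hE v ⟨v, v, fun u hu => absurd hu (hv u)⟩

end ThreeConnected

section TriangleClasses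

open SimpleGraph

variable {V : Type*} [Fintype V] [DecidableEq V] {G : SimpleGraph V} [DecidableRel G.Adj]

theorem SimpleGraph.three_le_card_coveredVertices {e : Sym2 V} (he : e ∈ G.edgeSet)
    (htri : ∀ a b, G.Adj a b → ∃ c, G.Adj a c ∧ G.Adj b c) :
    3 ≤ (coveredVertices (G.triangleClass e)).card := by
  induction e with
  | h a b =>
    obtain ⟨c, hac, hbc⟩ := htri a b he
    have h1 : s(a, b) ∈ G.triangleClass s(a, b) := (triangleClass_eq_iff he).1 rfl
    have h2 : s(a, c) ∈ G.triangleClass s(a, b) := mem_triangleClass_of_triangle h1 hac hbc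
    have hcard : ({a, b, c} : Finset V).card = 3 :=
      Finset.card_eq_three.2 ⟨a, b, c, G.ne_of_adj he, hac.ne, hbc.ne, rfl⟩
    rw [← hcard]
    refine Finset.card_le_card fun v hv => ?_
    rw [mem_coveredVertices]
    simp at hv
    rcases hv with rfl | rfl | rfl
    · exact ⟨_, h1⟩
    · exact ⟨a, by rwa [Sym2.eq_swap (a := v)]⟩
    · exact ⟨a, by rwa [Sym2.eq_swap (a := v)]⟩

/-- If the triangle class of `e` is not all of `G`, it meets the other classes in at least three
vertices. -/
theorem ThreeConnected.three_le_card_shared (h3 : ThreeConnected G)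
    (htri : ∀ a b, G.Adj a b → ∃ c, G.Adj a c ∧ G.Adj b c) {e f : Sym2 V} (he : e ∈ G.edgeSet)
    (hf : f ∈ G.edgeSet) (hfe : f ∉ G.triangleClass e) {A : Finset V}
    (hA : ∀ v, v ∈ coveredVertices (G.triangleClass e) →
      (∃ u, G.Adj v u ∧ s(v, u) ∉ G.triangleClass e) → v ∈ A) : 3 ≤ A.card := by
  by_contra! hlt
  have hce := three_le_card_coveredVertices he htri
  have hcf := three_le_card_coveredVertices hf htri
  obtain ⟨v, hv, hvA⟩ := Finset.exists_mem_notMem_of_card_lt_card (hlt.trans_le hce)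
  obtain ⟨y, hy, hyA⟩ := Finset.exists_mem_notMem_of_card_lt_card (hlt.trans_le hcf)
  have hyW := h3.mem_of_closed (A := A) (W := coveredVertices (G.triangleClass e)) (v := v)
    (y := y) (by rw [Set.ncard_coe_finset]; omega) hv hvA (fun x hx hxA z hxz => by
      rw [Finset.mem_coe, mem_coveredVertices]
      by_contra! hz
      exact hxA (hA x hx ⟨z, hxz, fun h' => hz x (Sym2.eq_swap ▸ h')⟩)) hyA
  obtain ⟨u, hu⟩ := mem_coveredVertices.1 hy
  have hu' := (mem_triangleClass.1 hu).1
  refine hyA (hA y hyW ⟨u, hu', fun h' => hfe ?_⟩)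
  rw [← triangleClass_eq_iff hf, ← (triangleClass_eq_iff hu').2 hu,
    (triangleClass_eq_iff hu').2 h']

/-- With at least two triangle classes the graph has at least `2n` edges. -/
theorem ThreeConnected.two_mul_card_le (h3 : ThreeConnected G)
    (htri : ∀ a b, G.Adj a b → ∃ c, G.Adj a c ∧ G.Adj b c)
    (hmany : ∀ e ∈ G.edgeSet, ∃ f ∈ G.edgeSet, f ∉ G.triangleClass e) :
    2 * Fintype.card V ≤ G.edgeFinset.card := by
  classical
  let 𝒞 := G.edgeFinset.image G.triangleClass
  let r : V → Finset (Sym2 V) → Prop := fun v C => v ∈ coveredVertices C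
  let c : V → ℕ := fun v => (𝒞.filter (r v)).card
  let w : V → ℕ := fun v => if 2 ≤ c v then 1 else 2
  have h1 : G.edgeFinset.card = ∑ C ∈ 𝒞, C.card := by
    rw [Finset.card_eq_sum_card_image G.triangleClass]
    refine Finset.sum_congr rfl fun C hC => ?_
    obtain ⟨e, he, rfl⟩ := Finset.mem_image.1 hC
    congr 1
    ext f
    rw [Finset.mem_filter, mem_edgeFinset]
    constructor
    · exact fun h => (triangleClass_eq_iff h.1).1 h.2
    · intro h
      have := (mem_triangleClass.1 h).1
      exact ⟨this, (triangleClass_eq_iff this).2 h⟩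
  have h2 : ∀ C ∈ 𝒞, ∑ v ∈ coveredVertices C, w v ≤ C.card := by
    intro C hC
    obtain ⟨e, he, rfl⟩ := Finset.mem_image.1 hC
    rw [mem_edgeFinset] at he
    obtain ⟨k, hk⟩ := exists_triBuild_triangleClass he
    have hcard := hk.card_eq
    obtain ⟨f, hf, hfe⟩ := hmany e he
    have hA := h3.three_le_card_shared htri he hf hfe
      (A := (coveredVertices (G.triangleClass e)).filter fun v => 2 ≤ c v) (by
        rintro v hv ⟨u, hvu, hu⟩
        rw [Finset.mem_filter]
        refine ⟨hv, ?_⟩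
        have hne : G.triangleClass s(v, u) ≠ G.triangleClass e := fun h' =>
          hu ((triangleClass_eq_iff hvu).1 h')
        rw [← Finset.card_pair hne]
        refine Finset.card_le_card ?_
        intro D hD
        rw [Finset.mem_filter]
        rcases Finset.mem_insert.1 hD with rfl | hD
        · exact ⟨Finset.mem_image_of_mem _ (mem_edgeFinset.2 hvu),
            mem_coveredVertices.2 ⟨u, (triangleClass_eq_iff hvu).1 rfl⟩⟩
        · rw [Finset.mem_singleton.1 hD]
          exact ⟨hC, hv⟩)
    have hsum : ∑ v ∈ coveredVertices (G.triangleClass e), w v +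
        ((coveredVertices (G.triangleClass e)).filter fun v => 2 ≤ c v).card =
        2 * (coveredVertices (G.triangleClass e)).card := by
      rw [Finset.card_filter, ← Finset.sum_add_distrib, mul_comm, ← smul_eq_mul,
        ← Finset.sum_const]
      refine Finset.sum_congr rfl fun v _ => ?_
      simp only [w]
      split <;> rfl
    omega
  have h4 : ∑ C ∈ 𝒞, ∑ v ∈ coveredVertices C, w v = ∑ v, c v * w v := by
    have : ∀ C ∈ 𝒞, ∑ v ∈ coveredVertices C, w v = ∑ v, if r v C then w v else 0 := by
      intro C _
      rw [← Finset.sum_filter]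
      refine Finset.sum_congr ?_ fun _ _ => rfl
      ext v
      simp [r]
    rw [Finset.sum_congr rfl this, Finset.sum_comm]
    refine Finset.sum_congr rfl fun v _ => ?_
    rw [← Finset.sum_filter, Finset.sum_const, smul_eq_mul]
  have h5 : ∀ v, 2 ≤ c v * w v := by
    intro v
    have hv : v ∈ coveredVertices G.edgeFinset := by
      rw [h3.covered_univ (fun a b hab => mem_edgeFinset.2 hab)]
      exact Finset.mem_univ v
    obtain ⟨u, hu⟩ := mem_coveredVertices.1 hv
    have hpos : 0 < c v := Finset.card_pos.2 ⟨G.triangleClass s(v, u), Finset.mem_filter.2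
      ⟨Finset.mem_image_of_mem _ hu, mem_coveredVertices.2
        ⟨u, (triangleClass_eq_iff (mem_edgeFinset.1 hu)).1 rfl⟩⟩⟩
    simp only [w]
    split <;> omega
  calc 2 * Fintype.card V = ∑ _v : V, 2 := by simp [mul_comm]
    _ ≤ ∑ v, c v * w v := Finset.sum_le_sum fun v _ => h5 v
    _ = ∑ C ∈ 𝒞, ∑ v ∈ coveredVertices C, w v := h4.symm
    _ ≤ ∑ C ∈ 𝒞, C.card := Finset.sum_le_sum h2
    _ = G.edgeFinset.card := h1.symm

end TriangleClasses

theorem wheelGraph_adj {n : ℕ} (a b : Fin n) :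
    (wheelGraph n).Adj a b ↔ a.val ≠ b.val ∧ (a.val = 0 ∨ b.val = 0 ∨ a.val + 1 = b.val ∨
      b.val + 1 = a.val ∨ (a.val = 1 ∧ b.val = n - 1) ∨ (b.val = 1 ∧ a.val = n - 1)) := by
  simp only [wheelGraph, SimpleGraph.fromRel_adj, ne_eq, Fin.ext_iff]
  omega

theorem ncard_edgeSet_wheelGraph {n : ℕ} (hn : 4 ≤ n) :
    (wheelGraph n).edgeSet.ncard = 2 * n - 2 := by
  classical
  obtain ⟨m, rfl⟩ : ∃ m, n = m + 1 := ⟨n - 1, by omega⟩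
  let f : Fin m ⊕ Fin m → Sym2 (Fin (m + 1)) := Sum.elim (fun i => s(0, i.succ))
    (fun i => s(i.succ, if h : i.val + 1 = m then ⟨1, by omega⟩ else ⟨i.val + 2, by omega⟩))
  have hf : Function.Injective f := by
    rintro (i | i) (j | j) hij <;>
      simp only [f, Sum.elim_inl, Sum.elim_inr, Sym2.eq_iff, Fin.ext_iff] at hij
    · simp at hij
      grind
    · simp at hij
      split at hij <;> simp at hij
    · simp at hij
      split at hij <;> simp at hij
    · split at hij <;> split at hij <;> simp at hij <;> grind
  have himg : (wheelGraph (m + 1)).edgeSet = Set.range f := by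
    ext e
    induction e with
    | h a b =>
      rw [SimpleGraph.mem_edgeSet, wheelGraph_adj]
      have hspoke : ∀ u v : Fin (m + 1), u.val = 0 → v.val ≠ 0 → s(u, v) ∈ Set.range f := by
        intro u v hu hv
        refine ⟨Sum.inl ⟨v.val - 1, by omega⟩, ?_⟩
        simp only [f, Sum.elim_inl, Sym2.eq_iff, Fin.ext_iff]
        simp
        omega
      have hrim : ∀ u v : Fin (m + 1), u.val ≠ 0 → (u.val + 1 = v.val ∨ (v.val = 1 ∧ u.val = m)) →
          s(u, v) ∈ Set.range f := by
        intro u v hu huv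
        refine ⟨Sum.inr ⟨u.val - 1, by omega⟩, ?_⟩
        simp only [f, Sum.elim_inr, Sym2.eq_iff, Fin.ext_iff]
        split <;> simp <;> omega
      constructor
      · intro h
        by_cases ha : a.val = 0
        · exact hspoke a b ha (by omega)
        by_cases hb : b.val = 0
        · rw [Sym2.eq_swap]
          exact hspoke b a hb ha
        by_cases hab : a.val + 1 = b.val ∨ (b.val = 1 ∧ a.val = m)
        · exact hrim a b ha hab
        · rw [Sym2.eq_swap]
          exact hrim b a hb (by omega)
      · rintro ⟨i | i, h⟩ <;>
          simp only [f, Sum.elim_inl, Sum.elim_inr, Sym2.eq_iff, Fin.ext_iff] at h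
        · simp at h
          omega
        · split at h <;> simp at h <;> omega
  rw [himg, ← Set.image_univ, Set.ncard_image_of_injective _ hf, Set.ncard_univ]
  simp
  omega

theorem IsFan.nonempty_iso_wheelGraph {V : Type*} [Fintype V] [DecidableEq V]
    {G : SimpleGraph V} {E : Finset (Sym2 V)} {x y z : V} {m : ℕ} {p : ℕ → V}
    (h : IsFan Finset.univ E x y z m p)
    (hG : ∀ a b, G.Adj a b ↔ s(a, b) ∈ insert s(x, y) E) :
    Nonempty (G ≃g wheelGraph (Fintype.card V)) := by
  have hm := h.two_le
  have hcard : Fintype.card V = m + 1 := by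
    have : (Finset.univ : Finset V) = (Finset.range (m + 1)).image p := by
      ext v
      rw [h.mem_iff]
      simp
    rw [← Finset.card_univ, this, Finset.card_image_of_injOn, Finset.card_range]
    intro i hi j hj hij
    simp at hi hj
    exact h.inj i (by omega) j (by omega) hij
  rw [hcard]
  let φ : Fin (m + 1) → V := fun i => p i
  have hφ : Function.Bijective φ := by
    constructor
    · intro i j hij
      exact Fin.ext (h.inj i (by omega) j (by omega) hij)
    · intro v
      obtain ⟨i, hi, rfl⟩ := (h.mem_iff v).1 (Finset.mem_univ v)
      exact ⟨⟨i, by omega⟩, rfl⟩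
  refine ⟨(RelIso.mk (Equiv.ofBijective φ hφ) ?_ : wheelGraph (m + 1) ≃g G).symm⟩
  intro i j
  have hi : i.val ≤ m := by omega
  have hj : j.val ≤ m := by omega
  show G.Adj (p i) (p j) ↔ _
  rw [hG, wheelGraph_adj, Finset.mem_insert, h.adj_iff i hi j hj, Sym2.eq_iff, ← h.first,
    ← h.last]
  have key : ∀ k ≤ m, ∀ l ≤ m, (p k = p l ↔ k = l) := fun k hk l hl =>
    ⟨h.inj k hk l hl, fun h' => h' ▸ rfl⟩
  rw [key i hi 1 (by omega), key i hi m le_rfl, key j hj 1 (by omega), key j hj m le_rfl]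
  omega

theorem SimpleGraph.EdgePancyclic.exists_common_neighbor {V : Type*} [Fintype V]
    {G : SimpleGraph V} (hG : G.EdgePancyclic) (hV : 3 ≤ Fintype.card V) (a b : V)
    (hab : G.Adj a b) : ∃ c, G.Adj a c ∧ G.Adj b c := by
  obtain ⟨v, c, hc, hlen, he⟩ := hG 3 le_rfl hV s(a, b) hab
  match c, hlen, he with
  | .cons h1 (.cons h2 (.cons h3 .nil)), _, he =>
    simp at he
    rcases he with (⟨rfl, rfl⟩ | ⟨rfl, rfl⟩) | (⟨rfl, rfl⟩ | ⟨rfl, rfl⟩) | (⟨rfl, rfl⟩ | ⟨rfl, rfl⟩)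
    · exact ⟨_, h3.symm, h2⟩
    · exact ⟨_, h2, h3.symm⟩
    · exact ⟨_, h1.symm, h3⟩
    · exact ⟨_, h3, h1.symm⟩
    · exact ⟨_, h2.symm, h1⟩
    · exact ⟨_, h1, h2.symm⟩

theorem ThreeConnected.nonempty_iso_wheelGraph {V : Type*} [Fintype V] [DecidableEq V]
    {G : SimpleGraph V} [DecidableRel G.Adj] (h3 : ThreeConnected G)
    (htri : ∀ a b, G.Adj a b → ∃ c, G.Adj a c ∧ G.Adj b c)
    (hb : TriBuild 1 Finset.univ G.edgeFinset) :
    Nonempty (G ≃g wheelGraph (Fintype.card V)) := by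
  have hadj : ∀ a b, G.Adj a b ↔ s(a, b) ∈ G.edgeFinset := fun a b => by
    rw [SimpleGraph.mem_edgeFinset, SimpleGraph.mem_edgeSet]
  have hlow := h3.not_low fun a b => (hadj a b).1
  generalize hS : (Finset.univ : Finset V) = S at hb
  generalize G.edgeFinset = E at hb hadj hlow
  cases hb with
  | @cone _ S E a b c h hab hc =>
    exact absurd ⟨a, b, fun u hu => (h.mem_cone_apex_iff hc).1 hu⟩ (hlow c)
  | @chord _ _ E x y h hx hy hxy hE =>
    obtain ⟨z, hxz, hyz⟩ := htri x y ((hadj x y).2 (Finset.mem_insert_self _ _))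
    have hxz' : s(x, z) ∈ E := by
      have := hyz.ne
      have := (hadj _ _).1 hxz
      simp at this
      grind
    have hyz' : s(y, z) ∈ E := by
      have := hxz.ne
      have := (hadj _ _).1 hyz
      simp at this
      grind
    subst hS
    obtain ⟨m, p, hp⟩ := h.exists_isFan rfl hxy hxz' hyz' (by
      rintro w - hwx hwy - ⟨a, b, hab⟩
      refine hlow w ⟨a, b, fun u hu => hab u ?_⟩
      simp at hu
      grind)
    exact hp.nonempty_iso_wheelGraph hadj

/-- a 3-connected edge-pancyclic graph of order `n` has at least `2n - 2` edges,
with equality iff it is isomorphic to the wheel `W_n`. -/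
theorem statement_2 {V : Type*} [Fintype V] (G : SimpleGraph V)
    (h3 : ThreeConnected G) (hG : G.EdgePancyclic) :
    2 * Fintype.card V - 2 ≤ G.edgeSet.ncard ∧
    (G.edgeSet.ncard = 2 * Fintype.card V - 2 ↔
      Nonempty (G ≃g wheelGraph (Fintype.card V))) := by
  classical
  have h4 := h3.1
  have htri := hG.exists_common_neighbor (by omega)
  have hcardE : G.edgeSet.ncard = G.edgeFinset.card := by
    rw [← SimpleGraph.coe_edgeFinset, Set.ncard_coe_finset]
  have key : 2 * Fintype.card V - 2 ≤ G.edgeFinset.card ∧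
      (G.edgeFinset.card = 2 * Fintype.card V - 2 →
        Nonempty (G ≃g wheelGraph (Fintype.card V))) := by
    by_cases hmany : ∀ e ∈ G.edgeSet, ∃ f ∈ G.edgeSet, f ∉ G.triangleClass e
    · have := h3.two_mul_card_le htri hmany
      exact ⟨by omega, fun h => by omega⟩
    push Not at hmany
    obtain ⟨e, he, hall⟩ := hmany
    have hclass : G.triangleClass e = G.edgeFinset := by
      ext f
      rw [SimpleGraph.mem_edgeFinset]
      exact ⟨fun h => (SimpleGraph.mem_triangleClass.1 h).1, hall f⟩
    have hadj : ∀ a b, G.Adj a b → s(a, b) ∈ G.edgeFinset := fun a b hab =>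
      SimpleGraph.mem_edgeFinset.2 hab
    obtain ⟨k, hk⟩ := SimpleGraph.exists_triBuild_triangleClass he
    rw [hclass, h3.covered_univ hadj] at hk
    have hcard := hk.card_eq
    rw [Finset.card_univ] at hcard
    have hk0 : k ≠ 0 := by
      rintro rfl
      induction e with
      | h a b =>
        obtain ⟨w, -, -, -, hw⟩ := hk.exists_low rfl (by rw [Finset.card_univ]; omega) (hadj a b he)
        exact h3.not_low hadj w hw
    refine ⟨by omega, fun heq => ?_⟩
    obtain rfl : k = 1 := by omega
    exact h3.nonempty_iso_wheelGraph htri hk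
  rw [hcardE]
  refine ⟨key.1, key.2, fun ⟨φ⟩ => ?_⟩
  rw [← hcardE, ← ncard_edgeSet_wheelGraph h4, ← Nat.card_coe_set_eq, ← Nat.card_coe_set_eq]
  exact Nat.card_congr φ.mapEdgeSet
end

section
/- For every integer k ≥ 2, the graph B_{3k+1} is a 3-edge-proper graph of order 3k + 1 with exactly 5k + 2 edges; hence the lower bound e(G) ≥ ⌈5n/3⌉ for 3-edge-proper graphs of order n is attained when n = 3k + 1. -/
/-- The graph `B_{3k+1}`: a cycle `v_1 … v_{2k+1} v_1` (here `Sum.inl i` is `v_{i+1}`)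
together with `k` extra vertices `u_1, …, u_k` (here `Sum.inr j` is `u_{j+1}`), where
`u_i` is joined to `v_{2i-1}`, `v_{2i}`, `v_{2i+1}`, plus the extra edge `v_{2k+1} v_2`. -/
def graphB (k : ℕ) : SimpleGraph (Fin (2 * k + 1) ⊕ Fin k) :=
  SimpleGraph.fromRel (fun a b =>
    match a, b with
    | Sum.inl i, Sum.inl i' =>
        (i.val + 1) % (2 * k + 1) = i'.val ∨ (i.val = 2 * k ∧ i'.val = 1)
    | Sum.inr j, Sum.inl i =>
        i.val = 2 * j.val ∨ i.val = 2 * j.val + 1 ∨ i.val = 2 * j.val + 2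
    | _, _ => False)

namespace SimpleGraph

variable {V : Type*} {G : SimpleGraph V}

/-- Every edge of a triangle lies in a cycle of length three. -/
lemma edgeInCycleOfLength_three {a b c : V} (hab : G.Adj a b) (hbc : G.Adj b c)
    (hca : G.Adj c a) : G.EdgeInCycleOfLength s(a, b) 3 := by
  refine ⟨a, .cons hab (.cons hbc (.cons hca .nil)), ?_, by simp, by simp⟩
  have := hab.ne
  have := hbc.ne
  have := hca.ne
  simp [Walk.cons_isCycle_iff, Walk.cons_isPath_iff]
  grind

/-- A cyclic enumeration of all vertices, consecutive ones being adjacent, gives a Hamilton cycle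
through every pair of consecutive vertices. -/
lemma exists_isHamiltonianCycle_of_cyclic_enumeration [DecidableEq V] {N : ℕ}
    (hN : 3 ≤ N) {f : Fin N → V} (hf : f.Bijective)
    (hadj : ∀ i (h : i + 1 < N), G.Adj (f ⟨i, by omega⟩) (f ⟨i + 1, h⟩))
    (hlast : G.Adj (f ⟨N - 1, by omega⟩) (f ⟨0, by omega⟩)) :
    ∃ (v : V) (c : G.Walk v v), c.IsHamiltonianCycle ∧
      (∀ i (h : i + 1 < N), s(f ⟨i, by omega⟩, f ⟨i + 1, h⟩) ∈ c.edges) ∧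
      s(f ⟨N - 1, by omega⟩, f ⟨0, by omega⟩) ∈ c.edges := by
  obtain ⟨n, rfl⟩ := Nat.exists_eq_add_of_le' hN
  have hstep (i j : Fin (n + 3)) (hij : j - i = 1) : G.Adj (f i) (f j) := by
    obtain rfl : j = i + 1 := by rw [← hij]; abel
    induction i using Fin.lastCases with
    | last =>
      rw [Fin.last_add_one]
      exact hlast
    | cast i =>
      have := hadj i (by omega)
      rwa [show i.castSucc + 1 = ⟨i + 1, by omega⟩ from i.coeSucc_eq_succ]
  let φ : cycleGraph (n + 3) →g G :=
    ⟨f, fun {i j} h => (cycleGraph_adj.1 h).elim (fun h => (hstep j i h).symm) (hstep i j)⟩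
  have hcycle : (cycleGraph.cycle n).IsHamiltonianCycle := by
    rw [Walk.isHamiltonianCycle_iff_isCycle_and_length_eq]
    exact ⟨cycleGraph.isCycle_cycle, by simp⟩
  refine ⟨_, (cycleGraph.cycle n).map φ, hcycle.map hf, fun i h => ?_, ?_⟩
  · have h1 := cycleGraph.getVert_cycle (n := n) (m := n + 3 - (i + 1)) (by omega)
    have h2 := cycleGraph.getVert_cycle (n := n) (m := n + 3 - (i + 1) + 1) (by omega)
    rw [Walk.edges_map]
    refine List.mem_map.2 ⟨s(⟨i, by omega⟩, ⟨i + 1, h⟩), ?_, rfl⟩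
    rw [Walk.mk_mem_edges_iff_exists]
    refine ⟨n + 3 - (i + 1), by simp; omega, ?_⟩
    rw [h1, h2, Sym2.eq_swap]
    congr 2
    · rw [Nat.mod_eq_of_lt (by omega)]
      omega
    · rw [Nat.mod_eq_of_lt (by omega)]
      omega
  · have h2 := cycleGraph.getVert_cycle (n := n) (m := 1) (by omega)
    rw [Walk.edges_map]
    refine List.mem_map.2 ⟨s(Fin.last (n + 2), 0), ?_, rfl⟩
    rw [Walk.mk_mem_edges_iff_exists]
    refine ⟨0, by simp, ?_⟩
    rw [Walk.getVert_zero, h2, Sym2.eq_swap]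
    congr 2
    simp

end SimpleGraph

namespace graphB

variable {k : ℕ}

lemma adj_inl_inl {i i' : Fin (2 * k + 1)} :
    (graphB k).Adj (Sum.inl i) (Sum.inl i') ↔ i.val ≠ i'.val ∧
      (i.val + 1 = i'.val ∨ i'.val + 1 = i.val ∨
        (i.val = 2 * k ∧ i'.val ≤ 1) ∨ (i'.val = 2 * k ∧ i.val ≤ 1)) := by
  have hmod (a b : Fin (2 * k + 1)) :
      (a.val + 1) % (2 * k + 1) = b.val ↔ a.val + 1 = b.val ∨ (a.val = 2 * k ∧ b.val = 0) := by
    rcases Nat.lt_or_ge (a.val + 1) (2 * k + 1) with h | h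
    · rw [Nat.mod_eq_of_lt h]
      omega
    · obtain h : a.val = 2 * k := by omega
      rw [h, Nat.mod_self]
      omega
  simp only [graphB, SimpleGraph.fromRel_adj, hmod, ne_eq, Sum.inl.injEq, Fin.ext_iff]
  have := i.isLt
  have := i'.isLt
  omega

lemma adj_inr_inl {j : Fin k} {i : Fin (2 * k + 1)} :
    (graphB k).Adj (Sum.inr j) (Sum.inl i) ↔
      2 * j.val ≤ i.val ∧ i.val ≤ 2 * j.val + 2 := by
  simp only [graphB, SimpleGraph.fromRel_adj, ne_eq, reduceCtorEq, not_false_eq_true, true_and,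
    or_false]
  omega

lemma adj_inl_inr {j : Fin k} {i : Fin (2 * k + 1)} :
    (graphB k).Adj (Sum.inl i) (Sum.inr j) ↔
      2 * j.val ≤ i.val ∧ i.val ≤ 2 * j.val + 2 := by
  rw [SimpleGraph.adj_comm, adj_inr_inl]

lemma not_adj_inr_inr {j j' : Fin k} : ¬ (graphB k).Adj (Sum.inr j) (Sum.inr j') := by
  simp [graphB]

/-- An enumeration of the edges of `graphB k`: the path edges `v_i v_{i+1}`, the two edges joining
the last `v` to the first two, and the edges at the vertices `u_j`. -/
def edge (k : ℕ) : Fin (2 * k) ⊕ Fin 2 ⊕ Fin k × Fin 3 → Sym2 (Fin (2 * k + 1) ⊕ Fin k)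
  | .inl i => s(.inl ⟨i, by omega⟩, .inl ⟨i + 1, by omega⟩)
  | .inr (.inl r) => s(.inl ⟨2 * k, by omega⟩, .inl ⟨r % (2 * k + 1), Nat.mod_lt _ (by omega)⟩)
  | .inr (.inr (j, r)) => s(.inr j, .inl ⟨2 * j + r, by omega⟩)

lemma edge_injective (hk : 2 ≤ k) : (edge k).Injective := by
  have hmod (r : Fin 2) : r.val % (2 * k + 1) = r.val := Nat.mod_eq_of_lt (by omega)
  rintro (i | r | ⟨j, r⟩) (i' | r' | ⟨j', r'⟩) h <;>
    simp [edge, Fin.ext_iff, hmod] at h ⊢ <;> omega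

lemma range_edge (hk : 2 ≤ k) : Set.range (edge k) = (graphB k).edgeSet := by
  have hmod (r : Fin 2) : r.val % (2 * k + 1) = r.val := Nat.mod_eq_of_lt (by omega)
  have hpath (i i' : Fin (2 * k + 1)) (h : i.val + 1 = i'.val) :
      s(.inl i, .inl i') ∈ Set.range (edge k) :=
    ⟨.inl ⟨i, by omega⟩, by simp [edge, h]⟩
  have hclose (i i' : Fin (2 * k + 1)) (h : i.val = 2 * k) (h' : i'.val ≤ 1) :
      s(.inl i, .inl i') ∈ Set.range (edge k) :=
    ⟨.inr (.inl ⟨i', by omega⟩), by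
      simp [edge, ← h, Nat.mod_eq_of_lt (show i'.val < i.val + 1 by omega)]⟩
  have hspoke (j : Fin k) (i : Fin (2 * k + 1)) (h : 2 * j.val ≤ i.val)
      (h' : i.val ≤ 2 * j.val + 2) : s(.inr j, .inl i) ∈ Set.range (edge k) :=
    ⟨.inr (.inr (j, ⟨i - 2 * j, by omega⟩)), by simp [edge, h]⟩
  ext e
  constructor
  · rintro ⟨i | r | ⟨j, r⟩, rfl⟩ <;>
      simp only [edge, SimpleGraph.mem_edgeSet, adj_inl_inl, adj_inr_inl, hmod, true_or, and_true,
        true_and] <;> omega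
  · induction e with | _ a b
    rw [SimpleGraph.mem_edgeSet]
    rcases a with i | j <;> rcases b with i' | j'
    · rw [adj_inl_inl]
      rintro ⟨-, h | h | ⟨h, h'⟩ | ⟨h, h'⟩⟩
      · exact hpath _ _ h
      · exact Sym2.eq_swap ▸ hpath _ _ h
      · exact hclose _ _ h h'
      · exact Sym2.eq_swap ▸ hclose _ _ h h'
    · rw [adj_inl_inr]
      rintro ⟨h, h'⟩
      exact Sym2.eq_swap ▸ hspoke _ _ h h'
    · rw [adj_inr_inl]
      rintro ⟨h, h'⟩
      exact hspoke _ _ h h'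
    · exact fun h => (not_adj_inr_inr h).elim

lemma ncard_edgeSet (hk : 2 ≤ k) : (graphB k).edgeSet.ncard = 5 * k + 2 := by
  rw [← range_edge hk, ← Set.image_univ, Set.ncard_image_of_injective _ (edge_injective hk),
    Set.ncard_univ, Nat.card_eq_fintype_card]
  simp
  ring

lemma edgeInCycleOfLength_three (hk : 2 ≤ k) {e : Sym2 (Fin (2 * k + 1) ⊕ Fin k)}
    (he : e ∈ (graphB k).edgeSet) : (graphB k).EdgeInCycleOfLength e 3 := by
  have hmod (r : Fin 2) : r.val % (2 * k + 1) = r.val := Nat.mod_eq_of_lt (by omega)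
  rw [← range_edge hk] at he
  obtain ⟨i | r | ⟨j, r⟩, rfl⟩ := he
  · refine SimpleGraph.edgeInCycleOfLength_three (c := .inr ⟨i / 2, by omega⟩) ?_ ?_ ?_ <;>
      simp only [adj_inl_inl, adj_inr_inl, adj_inl_inr, true_or, and_true] <;> omega
  · refine SimpleGraph.edgeInCycleOfLength_three (c := .inl ⟨1 - r, by omega⟩) ?_ ?_ ?_ <;>
      simp only [adj_inl_inl, hmod, true_and] <;> omega
  · refine SimpleGraph.edgeInCycleOfLength_three
      (c := .inl ⟨if r = 1 then 2 * j else 2 * j + 1, by split_ifs <;> omega⟩) ?_ ?_ ?_ <;>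
      simp only [adj_inl_inl, adj_inr_inl, adj_inl_inr] <;> grind

/-- The enumeration `v_1, v_2, u_1, v_3, v_4, u_2, …, v_{2k+1}` (for `r = 2`) or
`v_1, u_1, v_2, v_3, u_2, v_4, …, v_{2k+1}` (for `r = 1`) of the vertices of `graphB k`. -/
def enumeration (k r : ℕ) (hr : r = 1 ∨ r = 2) (i : Fin (3 * k + 1)) : Fin (2 * k + 1) ⊕ Fin k :=
  if h : i.val % 3 = r then .inr ⟨i / 3, by omega⟩
  else .inl ⟨2 * (i / 3) + (i % 3 + 1) / 2, by omega⟩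

lemma enumeration_eq_inl {r i m : ℕ} {hr : r = 1 ∨ r = 2} {hi : i < 3 * k + 1}
    {hm : m < 2 * k + 1} (h : i % 3 ≠ r) (h' : m = 2 * (i / 3) + (i % 3 + 1) / 2) :
    enumeration k r hr ⟨i, hi⟩ = .inl ⟨m, hm⟩ := by
  simp [enumeration, h, h']

lemma enumeration_eq_inr {r i j : ℕ} {hr : r = 1 ∨ r = 2} {hi : i < 3 * k + 1}
    {hj : j < k} (h : i % 3 = r) (h' : j = i / 3) :
    enumeration k r hr ⟨i, hi⟩ = .inr ⟨j, hj⟩ := by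
  simp [enumeration, h, h']

lemma enumeration_bijective (r : ℕ) (hr : r = 1 ∨ r = 2) : (enumeration k r hr).Bijective := by
  rw [Fintype.bijective_iff_injective_and_card]
  refine ⟨fun i j h => ?_, by simp; ring⟩
  simp only [enumeration] at h
  split_ifs at h <;> simp at h <;> omega

lemma adj_enumeration {r : ℕ} (hr : r = 1 ∨ r = 2) (i : ℕ) (h : i + 1 < 3 * k + 1) :
    (graphB k).Adj (enumeration k r hr ⟨i, by omega⟩) (enumeration k r hr ⟨i + 1, h⟩) := by
  simp only [enumeration]
  split_ifs
  · omega
  · rw [adj_inr_inl]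
    dsimp only
    omega
  · rw [adj_inl_inr]
    dsimp only
    omega
  · rw [adj_inl_inl]
    dsimp only
    omega

lemma exists_isHamiltonianCycle_enumeration (hk : 2 ≤ k) (r : ℕ) (hr : r = 1 ∨ r = 2) :
    ∃ (v : _) (c : (graphB k).Walk v v), c.IsHamiltonianCycle ∧
      (∀ i (h : i + 1 < 3 * k + 1),
        s(enumeration k r hr ⟨i, by omega⟩, enumeration k r hr ⟨i + 1, h⟩) ∈ c.edges) ∧
      s(enumeration k r hr ⟨3 * k, by omega⟩, enumeration k r hr ⟨0, by omega⟩) ∈ c.edges := by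
  refine SimpleGraph.exists_isHamiltonianCycle_of_cyclic_enumeration (by omega)
    (enumeration_bijective r hr) (adj_enumeration hr) ?_
  rw [enumeration_eq_inl (m := 2 * k) (hm := by omega) (by omega) (by omega),
    enumeration_eq_inl (m := 0) (hm := by omega) (by omega) (by omega), adj_inl_inl]
  dsimp only
  omega

/-- The chord joining the last `v` to the second one lies in the Hamilton cycle
`v_2, v_1, u_1, v_3, v_4, u_2, …, v_{2k+1}`. -/
lemma exists_isHamiltonianCycle_chord (hk : 2 ≤ k) :
    ∃ (v : _) (c : (graphB k).Walk v v), c.IsHamiltonianCycle ∧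
      s(.inl ⟨2 * k, by omega⟩, .inl ⟨1, by omega⟩) ∈ c.edges := by
  let σ : Equiv.Perm (Fin (3 * k + 1)) := Equiv.swap ⟨0, by omega⟩ ⟨1, by omega⟩
  have hσ₀ : σ ⟨0, by omega⟩ = ⟨1, by omega⟩ := Equiv.swap_apply_left _ _
  have hσ₁ : σ ⟨1, by omega⟩ = ⟨0, by omega⟩ := Equiv.swap_apply_right _ _
  have hσ (i : ℕ) (hi : 2 ≤ i) (hik : i < 3 * k + 1) : σ ⟨i, hik⟩ = ⟨i, hik⟩ :=
    Equiv.swap_apply_of_ne_of_ne (by rw [Ne, Fin.mk.injEq]; omega)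
      (by rw [Ne, Fin.mk.injEq]; omega)
  let f := enumeration k 2 (.inr rfl) ∘ σ
  have hf (i) : f i = enumeration k 2 (.inr rfl) (σ i) := rfl
  have hf₀ : f ⟨0, by omega⟩ = .inl ⟨1, by omega⟩ := by
    rw [hf, hσ₀]
    exact enumeration_eq_inl (by omega) (by omega)
  have hf₁ : f ⟨1, by omega⟩ = .inl ⟨0, by omega⟩ := by
    rw [hf, hσ₁]
    exact enumeration_eq_inl (by omega) (by omega)
  have hf₂ : f ⟨2, by omega⟩ = .inr ⟨0, by omega⟩ := by
    rw [hf, hσ _ (by omega)]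
    exact enumeration_eq_inr (by omega) (by omega)
  have hlast : f ⟨3 * k + 1 - 1, by omega⟩ = .inl ⟨2 * k, by omega⟩ := by
    rw [hf, hσ _ (by omega)]
    exact enumeration_eq_inl (by omega) (by omega)
  have hadj (i : ℕ) (h : i + 1 < 3 * k + 1) :
      (graphB k).Adj (f ⟨i, by omega⟩) (f ⟨i + 1, h⟩) := by
    match i with
    | 0 =>
      rw [hf₀, hf₁, adj_inl_inl]
      simp
    | 1 =>
      rw [hf₁, hf₂, adj_inl_inr]
      simp
    | i + 2 =>
      rw [hf, hf, hσ _ (by omega), hσ _ (by omega)]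
      exact adj_enumeration _ _ _
  obtain ⟨v, c, hc, -, h⟩ := SimpleGraph.exists_isHamiltonianCycle_of_cyclic_enumeration
    (by omega) (f := f) ((enumeration_bijective 2 (.inr rfl)).comp σ.bijective) hadj (by
      rw [hlast, hf₀, adj_inl_inl]
      dsimp only
      omega)
  refine ⟨v, c, hc, ?_⟩
  rwa [← hlast, ← hf₀]

lemma exists_isHamiltonianCycle (hk : 2 ≤ k) {e : Sym2 (Fin (2 * k + 1) ⊕ Fin k)}
    (he : e ∈ (graphB k).edgeSet) :
    ∃ (v : _) (c : (graphB k).Walk v v), c.IsHamiltonianCycle ∧ e ∈ c.edges := by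
  obtain ⟨v₁, c₁, hc₁, hstep₁, -⟩ := exists_isHamiltonianCycle_enumeration hk 1 (.inl rfl)
  obtain ⟨v₂, c₂, hc₂, hstep₂, hlast₂⟩ := exists_isHamiltonianCycle_enumeration hk 2 (.inr rfl)
  rw [← range_edge hk] at he
  obtain ⟨⟨i, hi⟩ | r | ⟨⟨j, hj⟩, r⟩, rfl⟩ := he
  · obtain ⟨m, rfl | rfl⟩ := i.even_or_odd'
    · have h := hstep₂ (3 * m) (by omega)
      rw [enumeration_eq_inl (m := 2 * m) (hm := by omega) (by omega) (by omega),
        enumeration_eq_inl (m := 2 * m + 1) (hm := by omega) (by omega) (by omega)] at h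
      exact ⟨v₂, c₂, hc₂, h⟩
    · have h := hstep₁ (3 * m + 2) (by omega)
      rw [enumeration_eq_inl (m := 2 * m + 1) (hm := by omega) (by omega) (by omega),
        enumeration_eq_inl (m := 2 * m + 2) (hm := by omega) (by omega) (by omega)] at h
      exact ⟨v₁, c₁, hc₁, h⟩
  · fin_cases r
    · rw [enumeration_eq_inl (m := 2 * k) (hm := by omega) (by omega) (by omega),
        enumeration_eq_inl (m := 0) (hm := by omega) (by omega) (by omega)] at hlast₂
      exact ⟨v₂, c₂, hc₂, by simpa [edge] using hlast₂⟩
    · obtain ⟨v, c, hc, h⟩ := exists_isHamiltonianCycle_chord hk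
      exact ⟨v, c, hc, by simpa [edge, Nat.mod_eq_of_lt (show 1 < 2 * k + 1 by omega)] using h⟩
  · fin_cases r
    · have h := hstep₁ (3 * j) (by omega)
      rw [enumeration_eq_inl (m := 2 * j) (hm := by omega) (by omega) (by omega),
        enumeration_eq_inr (j := j) (hj := hj) (by omega) (by omega), Sym2.eq_swap] at h
      exact ⟨v₁, c₁, hc₁, h⟩
    · have h := hstep₁ (3 * j + 1) (by omega)
      rw [enumeration_eq_inr (j := j) (hj := hj) (by omega) (by omega),
        enumeration_eq_inl (m := 2 * j + 1) (hm := by omega) (by omega) (by omega)] at h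
      exact ⟨v₁, c₁, hc₁, h⟩
    · have h := hstep₂ (3 * j + 2) (by omega)
      rw [enumeration_eq_inr (j := j) (hj := hj) (by omega) (by omega),
        enumeration_eq_inl (m := 2 * j + 2) (hm := by omega) (by omega) (by omega)] at h
      exact ⟨v₂, c₂, hc₂, h⟩

end graphB

/-- for `k ≥ 2`, `B_{3k+1}` is a 3-edge-proper graph of order `3k + 1` with
exactly `5k + 2` edges, attaining the bound `⌈5n/3⌉` for `n = 3k + 1`. -/
theorem statement_8 (k : ℕ) (hk : 2 ≤ k) :
    Fintype.card (Fin (2 * k + 1) ⊕ Fin k) = 3 * k + 1 ∧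
    (graphB k).EdgeProper 3 ∧
    (graphB k).edgeSet.ncard = 5 * k + 2 ∧
    ((graphB k).edgeSet.ncard : ℤ) = ⌈(5 * ((3 * k + 1 : ℕ) : ℚ)) / 3⌉ := by
  refine ⟨by simp; ring, fun e he => ⟨fun i h3 h3' => ?_, graphB.exists_isHamiltonianCycle hk he⟩,
    graphB.ncard_edgeSet hk, ?_⟩
  · obtain rfl : i = 3 := by omega
    exact graphB.edgeInCycleOfLength_three hk he
  · rw [graphB.ncard_edgeSet hk, eq_comm, Int.ceil_eq_iff]
    push_cast
    constructor <;> linarith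
end

section
/- Let k ≥ 4 and t ≥ 3 be integers and n = t(2k − 4). Let G be the graph of order n obtained from the cycle C_t = w_1 w_2 … w_t w_1 by replacing every edge w_i w_{i+1} with a copy of the fan graph F_{2k−3}, identifying w_i with the path-endpoint v_1 and w_{i+1} with the path-endpoint v_{2k−4} of the fan. Then G is k-edge-proper and e(G) = (4k − 9)t = (4k − 9)n/(2k − 4). -/
/-- The graph of order `t(2k-4)` obtained from a cycle `w_1 … w_t w_1` by replacing every edge
`w_i w_{i+1}` by an (internally disjoint) copy of the fan `F_{2k-3}`, identifying `w_i` with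
the path-endpoint `v_1` and `w_{i+1}` with the path-endpoint `v_{2k-4}` of the fan.  Here the
vertex `(i, j)` for `0 ≤ j ≤ 2k-6` is the path vertex `v_{j+1}` of the `i`-th fan (so
`(i, 0) = w_i`), the vertex `(i, 2k-5)` is the hub `u` of the `i`-th fan, and the path vertex
`v_{2k-4}` of the `i`-th fan is `(i + 1, 0) = w_{i+1}`. -/
def fanCycleGen (k t : ℕ) : SimpleGraph (Fin t × Fin (2 * k - 4)) :=
  SimpleGraph.fromRel (fun a b =>
    (a.1 = b.1 ∧ a.2.val + 1 = b.2.val ∧ b.2.val ≤ 2 * k - 6) ∨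
    (a.1 = b.1 ∧ a.2.val = 2 * k - 5 ∧ b.2.val ≤ 2 * k - 6) ∨
    (b.1.val = (a.1.val + 1) % t ∧ b.2.val = 0 ∧
      (a.2.val = 2 * k - 6 ∨ a.2.val = 2 * k - 5)))

namespace SimpleGraph

variable {V : Type*} {G : SimpleGraph V}

/-- A sequence of consecutively adjacent vertices is traversed by a walk. -/
theorem exists_walk_of_adj_succ (f : ℕ → V) (a l : ℕ)
    (hadj : ∀ q < l, G.Adj (f (a + q)) (f (a + q + 1))) :
    ∃ w : G.Walk (f a) (f (a + l)), w.length = l ∧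
      w.support = (List.range (l + 1)).map (fun q => f (a + q)) ∧
      w.edges = (List.range l).map (fun q => s(f (a + q), f (a + q + 1))) := by
  induction l with
  | zero => exact ⟨Walk.nil, by simp⟩
  | succ l ih =>
    obtain ⟨w, hl, hs, he⟩ := ih fun q hq => hadj q (by omega)
    refine ⟨w.concat (hadj l (by omega)), by simp [hl], ?_, ?_⟩
    · rw [Walk.support_concat, hs, List.range_succ (n := l + 1)]
      simp [← add_assoc]
    · rw [Walk.edges_concat, he, List.range_succ (n := l)]
      simp [← add_assoc]

/-- A closed sequence of at least three consecutively adjacent distinct vertices is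
traversed by a cycle. -/
theorem exists_isCycle_of_adj_succ (f : ℕ → V) (n : ℕ) (hn : 3 ≤ n) (hf : f n = f 0)
    (hadj : ∀ q < n, G.Adj (f q) (f (q + 1)))
    (hinj : ∀ p < n, ∀ q < n, f p = f q → p = q) :
    ∃ (v : V) (c : G.Walk v v), c.IsCycle ∧ c.length = n ∧
      ∀ q < n, s(f q, f (q + 1)) ∈ c.edges := by
  obtain ⟨w, hl, hs, he⟩ := exists_walk_of_adj_succ (G := G) f 1 (n - 1)
    fun q hq => by rw [add_comm 1 q]; exact hadj _ (by omega)
  have hend : f (1 + (n - 1)) = f 0 := by rw [← hf]; congr 1; omega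
  have hinj' : ∀ p ≤ n, ∀ q ≤ n, 0 < p → 0 < q → f p = f q → p = q := by
    intro p hp q hq hp0 hq0 h
    rcases hp.eq_or_lt with rfl | hp <;> rcases hq.eq_or_lt with rfl | hq
    · rfl
    · rw [hf] at h; have := hinj _ (by omega) _ hq h; omega
    · rw [hf] at h; have := hinj _ hp _ (by omega) h; omega
    · exact hinj _ hp _ hq h
  refine ⟨f 0, Walk.cons (hadj 0 (by omega)) (w.copy rfl hend), ?_, ?_, ?_⟩
  · rw [Walk.cons_isCycle_iff]
    constructor
    · rw [Walk.isPath_def, Walk.support_copy, hs]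
      refine List.Nodup.map_on ?_ List.nodup_range
      intro p hp q hq h
      rw [List.mem_range] at hp hq
      have := hinj' _ (by omega) _ (by omega) (by omega) (by omega) h
      omega
    · rw [Walk.edges_copy, he, List.mem_map]
      rintro ⟨q, hq, h⟩
      rw [List.mem_range] at hq
      rw [Sym2.eq_iff] at h
      rcases h with ⟨h, -⟩ | ⟨h, h'⟩
      · have := hinj _ (by omega) _ (by omega) h
        omega
      · rw [← hf] at h'
        have h1 := hinj' _ (by omega) _ (by omega) (by omega) (by omega) h
        have h2 := hinj' _ (by omega) _ (by omega) (by omega) (by omega) h'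
        omega
  · simp [hl]; omega
  · intro q hq
    rw [Walk.edges_cons, Walk.edges_copy, he]
    rcases q with _ | q
    · simp
    · refine List.mem_cons_of_mem _ (List.mem_map.2 ⟨q, by rw [List.mem_range]; omega, ?_⟩)
      simp [add_comm, add_left_comm]

end SimpleGraph

namespace FanCycle

variable {k t : ℕ}

/-- The cyclic successor of an index. -/
def next (i : Fin t) : Fin t := ⟨(i.val + 1) % t, Nat.mod_lt _ i.pos⟩

theorem val_next (i : Fin t) :
    (next i).val = i.val + 1 ∧ i.val + 1 < t ∨ (next i).val = 0 ∧ i.val + 1 = t := by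
  have hi := i.isLt
  rcases Nat.lt_or_ge (i.val + 1) t with h | h
  · exact Or.inl ⟨Nat.mod_eq_of_lt h, h⟩
  · have h' : i.val + 1 = t := by omega
    exact Or.inr ⟨by simp [next, h'], h'⟩

/-- The `j`-th vertex (counted from `0`) of the path of the `i`-th fan. -/
def pathVertex (hk : 4 ≤ k) (i : Fin t) (j : ℕ) : Fin t × Fin (2 * k - 4) :=
  if h : j < 2 * k - 5 then (i, ⟨j, by omega⟩) else (next i, ⟨0, by omega⟩)

/-- The hub of the `i`-th fan. -/
def hub (hk : 4 ≤ k) (i : Fin t) : Fin t × Fin (2 * k - 4) := (i, ⟨2 * k - 5, by omega⟩)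

theorem pathVertex_cases (hk : 4 ≤ k) (i : Fin t) (j : ℕ) :
    (j < 2 * k - 5 ∧ (pathVertex hk i j).1.val = i.val ∧ (pathVertex hk i j).2.val = j) ∨
    (2 * k - 5 ≤ j ∧ (pathVertex hk i j).1.val = (next i).val ∧
      (pathVertex hk i j).2.val = 0) := by
  unfold pathVertex
  split_ifs with h
  · exact Or.inl ⟨h, rfl, rfl⟩
  · exact Or.inr ⟨by omega, rfl, rfl⟩

theorem vertex_ext_iff {a b : Fin t × Fin (2 * k - 4)} :
    a = b ↔ a.1.val = b.1.val ∧ a.2.val = b.2.val := by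
  rw [Prod.ext_iff, Fin.ext_iff, Fin.ext_iff]

theorem pathVertex_eq_iff (hk : 4 ≤ k) (ht : 3 ≤ t) {i i' : Fin t} {j j' : ℕ}
    (hj : j ≤ 2 * k - 5) (hj' : j' ≤ 2 * k - 5) :
    pathVertex hk i j = pathVertex hk i' j' ↔
      (i.val = i'.val ∧ j = j') ∨ (j = 2 * k - 5 ∧ j' = 0 ∧ i'.val = (next i).val) ∨
      (j' = 2 * k - 5 ∧ j = 0 ∧ i.val = (next i').val) := by
  rw [vertex_ext_iff]
  have := pathVertex_cases hk i j
  have := pathVertex_cases hk i' j'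
  have := val_next i
  have := val_next i'
  omega

theorem pathVertex_inj (hk : 4 ≤ k) (ht : 3 ≤ t) {i : Fin t} {j j' : ℕ}
    (hj : j ≤ 2 * k - 5) (hj' : j' ≤ 2 * k - 5)
    (h : pathVertex hk i j = pathVertex hk i j') : j = j' := by
  rw [pathVertex_eq_iff hk ht hj hj'] at h
  have := val_next i
  omega

theorem hub_ne_pathVertex (hk : 4 ≤ k) (i i' : Fin t) (j : ℕ) :
    hub hk i ≠ pathVertex hk i' j := by
  rw [Ne, vertex_ext_iff]
  have := pathVertex_cases hk i' j
  have : (hub hk i).2.val = 2 * k - 5 := rfl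
  omega

theorem adj_iff (a b : Fin t × Fin (2 * k - 4)) :
    (fanCycleGen k t).Adj a b ↔ a ≠ b ∧
    (((a.1.val = b.1.val ∧ a.2.val + 1 = b.2.val ∧ b.2.val ≤ 2 * k - 6) ∨
    (a.1.val = b.1.val ∧ a.2.val = 2 * k - 5 ∧ b.2.val ≤ 2 * k - 6) ∨
    (b.1.val = (next a.1).val ∧ b.2.val = 0 ∧
      (a.2.val = 2 * k - 6 ∨ a.2.val = 2 * k - 5))) ∨
    ((b.1.val = a.1.val ∧ b.2.val + 1 = a.2.val ∧ a.2.val ≤ 2 * k - 6) ∨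
    (b.1.val = a.1.val ∧ b.2.val = 2 * k - 5 ∧ a.2.val ≤ 2 * k - 6) ∨
    (a.1.val = (next b.1).val ∧ a.2.val = 0 ∧
      (b.2.val = 2 * k - 6 ∨ b.2.val = 2 * k - 5)))) := by
  simp only [fanCycleGen, SimpleGraph.fromRel_adj, Fin.ext_iff, next]

theorem adj_path (hk : 4 ≤ k) (ht : 3 ≤ t) (i : Fin t) {j : ℕ} (hj : j < 2 * k - 5) :
    (fanCycleGen k t).Adj (pathVertex hk i j) (pathVertex hk i (j + 1)) := by
  rw [adj_iff]
  refine ⟨fun h => by have := pathVertex_inj hk ht (by omega) (by omega) h; omega, Or.inl ?_⟩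
  have h0 : (pathVertex hk i j).1 = i := by simp [pathVertex, hj]
  rw [h0]
  have := pathVertex_cases hk i j
  have := pathVertex_cases hk i (j + 1)
  omega

theorem adj_hub (hk : 4 ≤ k) (i : Fin t) (j : ℕ) :
    (fanCycleGen k t).Adj (hub hk i) (pathVertex hk i j) := by
  rw [adj_iff]
  refine ⟨hub_ne_pathVertex hk i i j, Or.inl ?_⟩
  have h1 : (hub hk i).1 = i := rfl
  have h2 : (hub hk i).2.val = 2 * k - 5 := rfl
  rw [h1, h2]
  have := pathVertex_cases hk i j
  omega

/-- The edges of the fans, indexed by the fan, with path edges before spokes. -/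
def edge (hk : 4 ≤ k) : Fin t × (Fin (2 * k - 5) ⊕ Fin (2 * k - 4)) →
    Sym2 (Fin t × Fin (2 * k - 4))
  | (i, Sum.inl j) => s(pathVertex hk i j, pathVertex hk i (j + 1))
  | (i, Sum.inr j) => s(hub hk i, pathVertex hk i j)

theorem exists_edge_eq (hk : 4 ≤ k) (a b : Fin t × Fin (2 * k - 4))
    (h : (a.1.val = b.1.val ∧ a.2.val + 1 = b.2.val ∧ b.2.val ≤ 2 * k - 6) ∨
      (a.1.val = b.1.val ∧ a.2.val = 2 * k - 5 ∧ b.2.val ≤ 2 * k - 6) ∨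
      (b.1.val = (next a.1).val ∧ b.2.val = 0 ∧
        (a.2.val = 2 * k - 6 ∨ a.2.val = 2 * k - 5))) :
    ∃ x, edge hk x = s(a, b) := by
  have key : ∀ (c : Fin t × Fin (2 * k - 4)) (i : Fin t) (j : ℕ),
      (j < 2 * k - 5 → i.val = c.1.val ∧ j = c.2.val) →
      (2 * k - 5 ≤ j → (next i).val = c.1.val ∧ 0 = c.2.val) → pathVertex hk i j = c := by
    intro c i j h1 h2
    rw [vertex_ext_iff]
    have := pathVertex_cases hk i j
    omega
  rcases h with h | h | h
  · refine ⟨(a.1, Sum.inl ⟨a.2.val, by omega⟩), ?_⟩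
    simp only [edge]
    rw [key a, key b] <;> omega
  · refine ⟨(a.1, Sum.inr b.2), ?_⟩
    have : hub hk a.1 = a := vertex_ext_iff.2 ⟨rfl, h.2.1.symm⟩
    simp only [edge]
    rw [this, key b] <;> omega
  · rcases h.2.2 with h' | h'
    · refine ⟨(a.1, Sum.inl ⟨a.2.val, by omega⟩), ?_⟩
      simp only [edge]
      rw [key a, key b] <;> omega
    · refine ⟨(a.1, Sum.inr ⟨2 * k - 5, by omega⟩), ?_⟩
      have : hub hk a.1 = a := vertex_ext_iff.2 ⟨rfl, h'.symm⟩
      simp only [edge]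
      rw [this, key b] <;> omega

theorem range_edge (hk : 4 ≤ k) (ht : 3 ≤ t) :
    Set.range (edge (t := t) hk) = (fanCycleGen k t).edgeSet := by
  ext e
  constructor
  · rintro ⟨⟨i, j | j⟩, rfl⟩
    · exact adj_path hk ht i j.isLt
    · exact adj_hub hk i j
  · induction e with | _ a b
    rw [SimpleGraph.mem_edgeSet, adj_iff]
    rintro ⟨-, h | h⟩
    · exact exists_edge_eq hk a b h
    · rw [Sym2.eq_swap]
      exact exists_edge_eq hk b a h

theorem edge_injective (hk : 4 ≤ k) (ht : 3 ≤ t) : Function.Injective (edge (t := t) hk) := by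
  rintro ⟨i, j | j⟩ ⟨i', j' | j'⟩ h <;> simp only [edge, Sym2.eq_iff] at h
  · have := j.isLt
    have := j'.isLt
    rw [pathVertex_eq_iff hk ht (by omega) (by omega),
      pathVertex_eq_iff hk ht (by omega) (by omega),
      pathVertex_eq_iff hk ht (by omega) (by omega),
      pathVertex_eq_iff hk ht (by omega) (by omega)] at h
    have := val_next i
    have := val_next i'
    have h1 : i = i' := Fin.ext (by omega)
    have h2 : j = j' := Fin.ext (by omega)
    rw [h1, h2]
  · rcases h with ⟨h, -⟩ | ⟨-, h⟩
    · exact absurd h.symm (hub_ne_pathVertex hk _ _ _)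
    · exact absurd h.symm (hub_ne_pathVertex hk _ _ _)
  · rcases h with ⟨h, -⟩ | ⟨h, -⟩
    · exact absurd h (hub_ne_pathVertex hk _ _ _)
    · exact absurd h (hub_ne_pathVertex hk _ _ _)
  · rcases h with ⟨h, h'⟩ | ⟨h, -⟩
    · have hi : i = i' := congrArg Prod.fst h
      subst hi
      have hj := pathVertex_inj hk ht (by omega) (by omega) h'
      rw [Fin.ext hj]
    · exact absurd h (hub_ne_pathVertex hk _ _ _)

/-- A segment of the path of a fan together with the hub forms a cycle. -/
theorem exists_isCycle_segment (hk : 4 ≤ k) (ht : 3 ≤ t) (i : Fin t) (a l : ℕ) (hl : 3 ≤ l)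
    (hal : a + l ≤ 2 * k - 3) :
    ∃ (v : _) (c : (fanCycleGen k t).Walk v v), c.IsCycle ∧ c.length = l ∧
      (∀ j, a ≤ j → j + 3 ≤ a + l →
        s(pathVertex hk i j, pathVertex hk i (j + 1)) ∈ c.edges) ∧
      s(hub hk i, pathVertex hk i a) ∈ c.edges ∧
      s(hub hk i, pathVertex hk i (a + l - 2)) ∈ c.edges := by
  set f : ℕ → Fin t × Fin (2 * k - 4) := fun q =>
    if q = 0 ∨ q = l then hub hk i else pathVertex hk i (a + q - 1) with hf
  have f0 : f 0 = hub hk i := by simp [hf]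
  have fl : f l = hub hk i := by simp [hf]
  have fp : ∀ q, 0 < q → q < l → f q = pathVertex hk i (a + q - 1) := fun q h1 h2 =>
    if_neg (by omega)
  obtain ⟨v, c, hc, hlen, he⟩ := SimpleGraph.exists_isCycle_of_adj_succ (G := fanCycleGen k t) f l hl
    (by rw [f0, fl]) (fun q hq => by
      rcases Nat.eq_zero_or_pos q with rfl | h0
      · rw [f0, fp _ (by omega) (by omega)]
        exact adj_hub hk i _
      · rw [fp q h0 hq]
        rcases Nat.lt_or_ge (q + 1) l with h | h
        · rw [fp _ (by omega) h]
          have := adj_path hk ht i (j := a + q - 1) (by omega)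
          rwa [show a + q - 1 + 1 = a + (q + 1) - 1 by omega] at this
        · rw [show q + 1 = l by omega, fl]
          exact (adj_hub hk i _).symm)
    (fun p hp q hq h => by
      rcases Nat.eq_zero_or_pos p with rfl | hp0 <;> rcases Nat.eq_zero_or_pos q with rfl | hq0
      · rfl
      · rw [f0, fp q hq0 hq] at h
        exact absurd h (hub_ne_pathVertex hk _ _ _)
      · rw [f0, fp p hp0 hp] at h
        exact absurd h.symm (hub_ne_pathVertex hk _ _ _)
      · rw [fp p hp0 hp, fp q hq0 hq] at h
        have := pathVertex_inj hk ht (by omega) (by omega) h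
        omega)
  refine ⟨v, c, hc, hlen, fun j h1 h2 => ?_, ?_, ?_⟩
  · have := he (j - a + 1) (by omega)
    rwa [fp _ (by omega) (by omega), fp _ (by omega) (by omega),
      show a + (j - a + 1) - 1 = j by omega, show a + (j - a + 1 + 1) - 1 = j + 1 by omega] at this
  · have := he 0 (by omega)
    rwa [f0, fp _ (by omega) (by omega), show a + (0 + 1) - 1 = a by omega] at this
  · have := he (l - 1) (by omega)
    rwa [fp _ (by omega) (by omega), show l - 1 + 1 = l by omega, fl,
      show a + (l - 1) - 1 = a + l - 2 by omega, Sym2.eq_swap] at this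

/-- The Hamilton path of the `i`-th fan which leaves the path at its `s`-th vertex, visits the
hub, and returns to the path at its `s + 1`-st vertex. -/
def detour (hk : 4 ≤ k) (s : ℕ) (i : Fin t) (p : ℕ) : Fin t × Fin (2 * k - 4) :=
  if p ≤ s then pathVertex hk i p else if p = s + 1 then hub hk i else pathVertex hk i (p - 1)

theorem detour_adj (hk : 4 ≤ k) (ht : 3 ≤ t) {s : ℕ} (hs : s < 2 * k - 5) (i : Fin t) {p : ℕ}
    (hp : p < 2 * k - 4) :
    (fanCycleGen k t).Adj (detour hk s i p) (detour hk s i (p + 1)) := by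
  unfold detour
  split_ifs <;> try omega
  · exact adj_path hk ht i (by omega)
  · exact (adj_hub hk i _).symm
  · exact adj_hub hk i _
  · have := adj_path hk ht i (j := p - 1) (by omega)
    rwa [show p - 1 + 1 = p + 1 - 1 by omega] at this

theorem detour_end (hk : 4 ≤ k) {s : ℕ} (hs : s < 2 * k - 5) (i : Fin t) :
    detour hk s i (2 * k - 4) = detour hk s (next i) 0 := by
  have h1 : detour hk s i (2 * k - 4) = pathVertex hk i (2 * k - 4 - 1) := by
    unfold detour
    split_ifs <;> first | rfl | omega
  have h2 : detour hk s (next i) 0 = pathVertex hk (next i) 0 := if_pos (Nat.zero_le s)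
  rw [h1, h2, vertex_ext_iff]
  have := pathVertex_cases hk i (2 * k - 4 - 1)
  have := pathVertex_cases hk (next i) 0
  omega

theorem detour_val (hk : 4 ≤ k) {s : ℕ} (hs : s < 2 * k - 5) (i : Fin t) {p : ℕ}
    (hp : p < 2 * k - 4) :
    (detour hk s i p).1.val = i.val ∧ (detour hk s i p).2.val =
      if p ≤ s then p else if p = s + 1 then 2 * k - 5 else p - 1 := by
  unfold detour
  split_ifs
  · have := pathVertex_cases hk i p
    omega
  · exact ⟨rfl, rfl⟩
  · have := pathVertex_cases hk i (p - 1)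
    omega

/-- Concatenating the Hamilton paths `detour` of all fans gives a Hamilton cycle. -/
theorem exists_isHamiltonianCycle_detour (hk : 4 ≤ k) (ht : 3 ≤ t) {s : ℕ} (hs : s < 2 * k - 5) :
    ∃ (v : _) (c : (fanCycleGen k t).Walk v v), c.IsHamiltonianCycle ∧
      ∀ i : Fin t, ∀ p < 2 * k - 4, s(detour hk s i p, detour hk s i (p + 1)) ∈ c.edges := by
  obtain ⟨m, hm⟩ : ∃ m, m = 2 * k - 4 := ⟨_, rfl⟩
  have hm0 : 0 < m := by omega
  set ix : ℕ → Fin t := fun r => ⟨r % t, Nat.mod_lt _ (by omega)⟩ with hix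
  have next_ix : ∀ r, next (ix r) = ix (r + 1) := fun r => by
    simp [next, hix, Nat.mod_add_mod]
  set f : ℕ → Fin t × Fin (2 * k - 4) := fun q => detour hk s (ix (q / m)) (q % m) with hf
  have fsucc : ∀ q, f (q + 1) = detour hk s (ix (q / m)) (q % m + 1) := by
    intro q
    have hq := Nat.mod_lt q hm0
    have hdm := Nat.div_add_mod q m
    rcases Nat.lt_or_ge (q % m + 1) m with h | h
    · have h1 : (q + 1) / m = q / m := Nat.div_eq_of_lt_le (by linarith [Nat.zero_le (q % m)]) (by nlinarith)
      have h2 : (q + 1) % m = q % m + 1 := by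
        have := Nat.div_add_mod (q + 1) m
        rw [h1] at this
        omega
      simp only [hf, h1, h2]
    · have h0 : q + 1 = m * (q / m + 1) := by rw [mul_add]; omega
      have h1 : (q + 1) / m = q / m + 1 := by rw [h0]; exact Nat.mul_div_cancel_left _ hm0
      have h2 : (q + 1) % m = 0 := by rw [h0]; exact Nat.mul_mod_right _ _
      simp only [hf, h1, h2]
      rw [← next_ix, ← detour_end hk hs, show q % m + 1 = 2 * k - 4 by omega]
  have hfn : f (t * m) = f 0 := by
    simp [hf, hix, Nat.mul_div_cancel _ hm0]
  obtain ⟨v, c, hc, hlen, he⟩ := SimpleGraph.exists_isCycle_of_adj_succ (G := fanCycleGen k t) f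
    (t * m) (by nlinarith) hfn
    (fun q _ => by
      rw [fsucc]
      exact detour_adj hk ht hs _ (by have := Nat.mod_lt q hm0; omega))
    (fun p hp q hq h => by
      have hp' := Nat.mod_lt p hm0
      have hq' := Nat.mod_lt q hm0
      have vp := detour_val hk hs (ix (p / m)) (p := p % m) (by omega)
      have vq := detour_val hk hs (ix (q / m)) (p := q % m) (by omega)
      simp only [hf] at h
      rw [← h] at vq
      have e1 : p / m = q / m := by
        have := vp.1.symm.trans vq.1
        simpa [hix, Nat.mod_eq_of_lt ((Nat.div_lt_iff_lt_mul hm0).2 hp),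
          Nat.mod_eq_of_lt ((Nat.div_lt_iff_lt_mul hm0).2 hq)] using this
      have e2 : p % m = q % m := by
        have := vp.2.symm.trans vq.2
        split_ifs at this <;> omega
      rw [← Nat.div_add_mod p m, ← Nat.div_add_mod q m, e1, e2])
  refine ⟨v, c, ?_, fun i p hp => ?_⟩
  · rw [SimpleGraph.Walk.isHamiltonianCycle_iff_isCycle_and_length_eq]
    exact ⟨hc, by simp [hlen, hm]⟩
  · have hlt : m * i.val + p < t * m := by
      have := i.isLt
      nlinarith
    have hd : (m * i.val + p) / m = i.val := by
      rw [Nat.mul_add_div hm0, Nat.div_eq_of_lt (by omega), add_zero]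
    have hr : (m * i.val + p) % m = p := by
      rw [Nat.mul_add_mod, Nat.mod_eq_of_lt (by omega)]
    have hi : ix i.val = i := Fin.ext (Nat.mod_eq_of_lt i.isLt)
    have := he _ hlt
    rw [fsucc] at this
    simpa only [hf, hd, hr, hi] using this

theorem edgeProper (hk : 4 ≤ k) (ht : 3 ≤ t) : (fanCycleGen k t).EdgeProper k := by
  intro e he
  rw [← range_edge hk ht] at he
  obtain ⟨⟨i, j | j⟩, rfl⟩ := he
  · have hj := j.isLt
    refine ⟨fun l hl hlk => ?_, ?_⟩
    · obtain ⟨v, c, hc, hlen, hpath, -, -⟩ :=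
        exists_isCycle_segment hk ht i (min j.val (2 * k - 3 - l)) l hl (by omega)
      exact ⟨v, c, hc, hlen, hpath j (by omega) (by omega)⟩
    · rcases Nat.eq_zero_or_pos j.val with h0 | h0
      · obtain ⟨v, c, hc, hmem⟩ :=
          exists_isHamiltonianCycle_detour hk ht (s := 1) (by omega)
        refine ⟨v, c, hc, ?_⟩
        simpa [edge, detour, h0] using hmem i 0 (by omega)
      · obtain ⟨v, c, hc, hmem⟩ :=
          exists_isHamiltonianCycle_detour hk ht (s := 0) (by omega)
        refine ⟨v, c, hc, ?_⟩
        have := hmem i (j.val + 1) (by omega)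
        simpa [edge, detour, h0.ne'] using this
  · have hj := j.isLt
    refine ⟨fun l hl hlk => ?_, ?_⟩
    · rcases Nat.lt_or_ge (2 * k - 3) (j.val + l) with h | h
      · obtain ⟨v, c, hc, hlen, -, -, hmem⟩ :=
          exists_isCycle_segment hk ht i (j.val + 2 - l) l hl (by omega)
        rw [show j.val + 2 - l + l - 2 = j.val by omega] at hmem
        exact ⟨v, c, hc, hlen, hmem⟩
      · obtain ⟨v, c, hc, hlen, -, hmem, -⟩ := exists_isCycle_segment hk ht i j.val l hl h
        exact ⟨v, c, hc, hlen, hmem⟩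
    · rcases Nat.lt_or_ge j.val (2 * k - 5) with h | h
      · obtain ⟨v, c, hc, hmem⟩ := exists_isHamiltonianCycle_detour hk ht h
        refine ⟨v, c, hc, ?_⟩
        rw [edge, Sym2.eq_swap]
        simpa [detour] using hmem i j.val hj
      · obtain ⟨v, c, hc, hmem⟩ :=
          exists_isHamiltonianCycle_detour hk ht (s := j.val - 1) (by omega)
        refine ⟨v, c, hc, ?_⟩
        have hj1 : j.val - 1 + 1 = j.val := by omega
        have hj2 : ¬ j.val ≤ j.val - 1 := by omega
        have hj3 : ¬ j.val + 1 ≤ j.val - 1 := by omega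
        simpa [edge, detour, hj1, hj2, hj3] using hmem i j.val hj

theorem ncard_edgeSet (hk : 4 ≤ k) (ht : 3 ≤ t) :
    (fanCycleGen k t).edgeSet.ncard = (4 * k - 9) * t := by
  rw [← range_edge hk ht, Set.ncard_range_of_injective (edge_injective hk ht)]
  simp only [Nat.card_eq_fintype_card, Fintype.card_prod, Fintype.card_sum, Fintype.card_fin]
  rw [mul_comm]
  congr 1
  omega

end FanCycle

/-- for `k ≥ 4`, `t ≥ 3` and `n = t(2k - 4)`, the graph obtained from `C_t`
by replacing each edge by a fan `F_{2k-3}` is `k`-edge-proper with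
`e(G) = (4k - 9)t = (4k - 9)n/(2k - 4)`. -/
theorem statement_12 (k t : ℕ) (hk : 4 ≤ k) (ht : 3 ≤ t) :
    Fintype.card (Fin t × Fin (2 * k - 4)) = t * (2 * k - 4) ∧
    (fanCycleGen k t).EdgeProper k ∧
    (fanCycleGen k t).edgeSet.ncard = (4 * k - 9) * t := by
  exact ⟨by simp, FanCycle.edgeProper hk ht, FanCycle.ncard_edgeSet hk ht⟩
end
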